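/- arXiv:1601.04975 — 4 statements merged into one kernel-verified Lean document; each statement's English description precedes it below -/
import Mathlib

section
/- Let n ≥ 2 and let Σ be a finite set of n×n row-stochastic real matrices. Then every left-infinite product of matrices from Σ converges to a rank-one matrix if and only if for every finite product Q = A_p ⋯ A_1 of matrices from Σ of length p with 1 ≤ p ≤ p*(n) = C(n, ⌊n/3⌋)·(2^{n − ⌊n/3⌋ − 1} − 1), the sequence of powers Q^t converges, as t → ∞, to a matrix of rank one. -/
open Filter Matrix

/-- A matrix is (row-)stochastic if its entries are nonnegative and each row sums to 1. -/
def IsStochastic {n : ℕ} (A : Matrix (Fin n) (Fin n) ℝ) : Prop :=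
  (∀ i j, 0 ≤ A i j) ∧ ∀ i, ∑ j, A i j = 1

/-- Partial products `P t = σ(t) ⋯ σ(1)` of a sequence of matrices (P 0 = identity). -/
def partialProd {n : ℕ} (σ : ℕ → Matrix (Fin n) (Fin n) ℝ) : ℕ → Matrix (Fin n) (Fin n) ℝ
  | 0 => 1
  | t + 1 => σ (t + 1) * partialProd σ t

/-- A sequence of matrices converges (entrywise) to a rank-one matrix. -/
def ConvergesToRankOne {n : ℕ} (P : ℕ → Matrix (Fin n) (Fin n) ℝ) : Prop :=
  ∃ L : Matrix (Fin n) (Fin n) ℝ, L.rank = 1 ∧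
    ∀ i j, Tendsto (fun t => P t i j) atTop (nhds (L i j))

/-- The bound `p*(n) = C(n, ⌊n/3⌋) · (2^(n − ⌊n/3⌋ − 1) − 1)`. -/
def pstar (n : ℕ) : ℕ := n.choose (n / 3) * (2 ^ (n - n / 3 - 1) - 1)

/-- The number of ordered pairs of disjoint nonempty subsets of total size `m` in an `n`-set. -/
noncomputable def pairLevel (n m : ℕ) : ℝ := n.choose m * (2 ^ m - 2)

/-- The sum of the binomial coefficients `C(m, i)` for `1 ≤ i ≤ a`. -/
noncomputable def binomSum (m a : ℕ) : ℝ := ∑ i ∈ Finset.range a, (m.choose (i + 1) : ℝ)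

lemma binomSum_succ (m a : ℕ) : binomSum m (a + 1) = binomSum m a + m.choose (a + 1) := by
  simp [binomSum, Finset.sum_range_succ]

lemma binomSum_nonneg (m a : ℕ) : 0 ≤ binomSum m a := by
  unfold binomSum; positivity

lemma binomSum_self (m : ℕ) : binomSum (m + 1) m = 2 ^ (m + 1) - 2 := by
  have h := Nat.sum_range_choose (m + 1)
  rw [Finset.sum_range_succ, Finset.sum_range_succ'] at h
  have h' : (∑ i ∈ Finset.range m, ((m + 1).choose (i + 1) : ℝ)) + 1 + 1 = 2 ^ (m + 1) := by
    have := congrArg (Nat.cast (R := ℝ)) h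
    push_cast at this
    simpa using this
  unfold binomSum; linarith

lemma binomSum_le {m a : ℕ} (h : a ≤ m) : binomSum (m + 1) a ≤ 2 ^ (m + 1) - 2 := by
  rw [← binomSum_self]
  unfold binomSum
  exact Finset.sum_le_sum_of_subset_of_nonneg (Finset.range_subset_range.2 h)
    fun _ _ _ => by positivity

lemma binomSum_pascal (m a : ℕ) :
    binomSum (m + 1) a = 2 * binomSum m a + 1 - m.choose a := by
  induction a with
  | zero => simp [binomSum]
  | succ a ih =>
    rw [binomSum_succ, binomSum_succ, ih, Nat.choose_succ_succ]
    push_cast; ring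

lemma two_pow_sub_two_pos {m : ℕ} (hm : 2 ≤ m) : (0 : ℝ) < 2 ^ m - 2 := by
  have : (2 : ℝ) ^ 2 ≤ 2 ^ m := pow_le_pow_right₀ (by norm_num) hm
  linarith

/-- Mass moved from type `(a, m - a)` to type `(a + 1, m - a)` between consecutive levels. -/
noncomputable def massLeft (m a : ℕ) : ℝ :=
  binomSum m a / (2 ^ m - 2) - binomSum (m + 1) a / (2 ^ (m + 1) - 2)

/-- Mass moved from type `(a, m - a)` to type `(a, m - a + 1)` between consecutive levels. -/
noncomputable def massRight (m a : ℕ) : ℝ :=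
  binomSum (m + 1) a / (2 ^ (m + 1) - 2) - binomSum m (a - 1) / (2 ^ m - 2)

lemma massLeft_zero (m : ℕ) : massLeft m 0 = 0 := by simp [massLeft, binomSum]

lemma massRight_self {m : ℕ} (hm : 2 ≤ m) : massRight m m = 0 := by
  obtain ⟨k, rfl⟩ : ∃ k, m = k + 1 := ⟨m - 1, by omega⟩
  have h1 := two_pow_sub_two_pos hm
  have h2 := two_pow_sub_two_pos (show 2 ≤ k + 1 + 1 by omega)
  rw [massRight, binomSum_self, Nat.add_sub_cancel, binomSum_self, div_self h1.ne',
    div_self h2.ne', sub_self]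

lemma massLeft_nonneg {m a : ℕ} (hm : 2 ≤ m) (ha : a ≤ m) : 0 ≤ massLeft m a := by
  have h1 := two_pow_sub_two_pos hm
  have h2 := two_pow_sub_two_pos (show 2 ≤ m + 1 by omega)
  have hc : (1 : ℝ) ≤ m.choose a := by exact_mod_cast Nat.choose_pos ha
  have hb := binomSum_nonneg m a
  rw [massLeft, sub_nonneg, div_le_div_iff₀ h2 h1, binomSum_pascal, pow_succ]
  nlinarith [mul_nonneg (sub_nonneg.2 hc) h1.le]

lemma massRight_nonneg {m a : ℕ} (hm : 2 ≤ m) (ha : 1 ≤ a) (ham : a ≤ m) :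
    0 ≤ massRight m a := by
  have h1 := two_pow_sub_two_pos hm
  have h2 := two_pow_sub_two_pos (show 2 ≤ m + 1 by omega)
  have hc : (1 : ℝ) ≤ m.choose a := by exact_mod_cast Nat.choose_pos ham
  obtain ⟨b, rfl⟩ : ∃ b, a = b + 1 := ⟨a - 1, by omega⟩
  obtain ⟨k, rfl⟩ : ∃ k, m = k + 1 := ⟨m - 1, by omega⟩
  have hb := binomSum_le (show b ≤ k by omega)
  rw [massRight, sub_nonneg, Nat.add_sub_cancel, div_le_div_iff₀ h1 h2, binomSum_pascal (k + 1),
    binomSum_succ (k + 1), pow_succ _ (k + 1)]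
  nlinarith [mul_nonneg (sub_nonneg.2 hc) h1.le]

lemma massLeft_add_massRight {m a : ℕ} (ha : 1 ≤ a) :
    massLeft m a + massRight m a = m.choose a / (2 ^ m - 2) := by
  obtain ⟨b, rfl⟩ : ∃ b, a = b + 1 := ⟨a - 1, by omega⟩
  rw [massLeft, massRight, Nat.add_sub_cancel, binomSum_succ]
  ring

lemma massLeft_pred_add_massRight {m a : ℕ} (ha : 1 ≤ a) :
    massLeft m (a - 1) + massRight m a = (m + 1).choose a / (2 ^ (m + 1) - 2) := by
  obtain ⟨b, rfl⟩ : ∃ b, a = b + 1 := ⟨a - 1, by omega⟩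
  rw [massLeft, massRight, Nat.add_sub_cancel, binomSum_succ (m + 1)]
  ring

lemma pairLevel_pos {n m : ℕ} (hm : 2 ≤ m) (hmn : m ≤ n) : 0 < pairLevel n m :=
  mul_pos (by exact_mod_cast Nat.choose_pos hmn) (two_pow_sub_two_pos hm)

/-- A nonnegative normalized flow between consecutive levels, depending only on block sizes. -/
lemma exists_flow {n m : ℕ} (hm : 2 ≤ m) (hmn : m < n) :
    ∃ u v : ℕ → ℝ, (∀ a ≤ m, 0 ≤ u a) ∧ (∀ a, 1 ≤ a → a ≤ m → 0 ≤ v a) ∧ u 0 = 0 ∧ v m = 0 ∧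
      (∀ a, 1 ≤ a → a ≤ m → (n - m : ℝ) * (u a + v a) = (pairLevel n m)⁻¹) ∧
      (∀ a b, 1 ≤ a → 1 ≤ b → a + b = m + 1 →
        a * u (a - 1) + b * v a = (pairLevel n (m + 1))⁻¹) := by
  have hnm : (0 : ℝ) < n - m := by
    have : (m : ℝ) < n := by exact_mod_cast hmn
    linarith
  have hC : (0 : ℝ) < n.choose m := by exact_mod_cast Nat.choose_pos hmn.le
  have h1 := two_pow_sub_two_pos hm
  have h2 := two_pow_sub_two_pos (show 2 ≤ m + 1 by omega)
  refine ⟨fun a => massLeft m a / (m.choose a * ((n - m) * n.choose m)),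
    fun a => massRight m a / (m.choose a * ((n - m) * n.choose m)), ?_, ?_, ?_, ?_, ?_, ?_⟩
  · intro a ha
    have := massLeft_nonneg hm ha
    positivity
  · intro a ha ham
    have := massRight_nonneg hm ha ham
    positivity
  · simp [massLeft_zero]
  · simp [massRight_self hm]
  · intro a ha ham
    have hc : (0 : ℝ) < m.choose a := by exact_mod_cast Nat.choose_pos ham
    have h := massLeft_add_massRight (m := m) ha
    rw [← add_div, h, pairLevel]
    field_simp
  · intro a b ha hb hab
    obtain ⟨c, rfl⟩ : ∃ c, a = c + 1 := ⟨a - 1, by omega⟩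
    have h := massLeft_pred_add_massRight (m := m) ha
    have hc : (0 : ℝ) < m.choose (c + 1) := by exact_mod_cast Nat.choose_pos (by omega)
    have hc0 : (0 : ℝ) < m.choose c := by exact_mod_cast Nat.choose_pos (by omega)
    have hc' : (0 : ℝ) < (m + 1).choose (c + 1) := by exact_mod_cast Nat.choose_pos (by omega)
    have e1 : ((m + 1 : ℕ) : ℝ) * m.choose c = (m + 1).choose (c + 1) * ((c + 1 : ℕ) : ℝ) := by
      exact_mod_cast Nat.add_one_mul_choose_eq m c
    have e2 : ((m + 1).choose (c + 1) : ℝ) * b = (m + 1 : ℕ) * m.choose (c + 1) := by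
      have := Nat.choose_mul_succ_eq m (c + 1)
      rw [show m + 1 - (c + 1) = b by omega] at this
      rw [mul_comm ((m + 1 : ℕ) : ℝ)]
      exact_mod_cast this.symm
    have e3 : (n.choose (m + 1) : ℝ) * (m + 1 : ℕ) = n.choose m * (n - m) := by
      have := Nat.choose_succ_right_eq n m
      rw [← Nat.cast_sub hmn.le]
      exact_mod_cast this
    have hC' : (0 : ℝ) < n.choose (m + 1) := by exact_mod_cast Nat.choose_pos (by omega)
    rw [mul_comm _ ((n : ℝ) - m)] at e3
    have hm0 : (0 : ℝ) < (m + 1 : ℕ) := by positivity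
    have k1 : ((c + 1 : ℕ) : ℝ) / m.choose c = (m + 1 : ℕ) / (m + 1).choose (c + 1) := by
      rw [div_eq_div_iff hc0.ne' hc'.ne']; linarith
    have k2 : (b : ℝ) / m.choose (c + 1) = (m + 1 : ℕ) / (m + 1).choose (c + 1) := by
      rw [div_eq_div_iff hc.ne' hc'.ne']; linarith
    rw [← e3, pairLevel]
    calc _ = (((c + 1 : ℕ) : ℝ) / m.choose c * massLeft m c
          + b / m.choose (c + 1) * massRight m (c + 1))
            / (n.choose (m + 1) * (m + 1 : ℕ)) := by
            simp only [Nat.add_sub_cancel]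
            field_simp
      _ = _ := by
            rw [k1, k2, ← mul_add]
            rw [Nat.add_sub_cancel] at h
            rw [h]
            field_simp

lemma choose_mul_le_of_lt_third {n j : ℕ} (h : 3 * (j + 1) ≤ n) :
    n.choose j * (2 ^ (n - j) - 2) ≤ n.choose (j + 1) * (2 ^ (n - (j + 1)) - 2) := by
  obtain ⟨m, rfl⟩ : ∃ m, n = j + (m + 1) := ⟨n - j - 1, by omega⟩
  have e := Nat.choose_succ_right_eq (j + (m + 1)) j
  rw [show j + (m + 1) - j = m + 1 by omega] at e ⊢
  rw [show j + (m + 1) - (j + 1) = m by omega]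
  have hX : m + 2 ≤ 2 ^ m := by
    obtain ⟨k, rfl⟩ : ∃ k, m = k + 2 := ⟨m - 2, by omega⟩
    have := Nat.lt_two_pow_self (n := k)
    rw [pow_add]; omega
  obtain ⟨X, hX'⟩ : ∃ X, 2 ^ m = X + 2 := ⟨2 ^ m - 2, by omega⟩
  rw [pow_succ, hX']
  have : (X + 2) * 2 - 2 = 2 * X + 2 := by omega
  rw [this, Nat.add_sub_cancel]
  refine Nat.le_of_mul_le_mul_right (c := j + 1) ?_ (by omega)
  calc _ = (j + (m + 1)).choose j * (2 * (j + 1) * (X + 1)) := by ring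
    _ ≤ (j + (m + 1)).choose j * ((m + 1) * X) := by
        refine Nat.mul_le_mul_left _ ?_
        have h3 : 2 * (j + 1) ≤ m := by omega
        have h4 : m ≤ X := by omega
        nlinarith [Nat.mul_le_mul_right (X + 1) h3]
    _ = _ := by rw [← mul_assoc, ← e]; ring

lemma choose_mul_le_of_third_le {n j : ℕ} (h : n ≤ 3 * j + 2) (hj : j + 1 < n) :
    n.choose (j + 1) * (2 ^ (n - (j + 1)) - 2) ≤ n.choose j * (2 ^ (n - j) - 2) := by
  obtain ⟨m, rfl⟩ : ∃ m, n = j + (m + 1) := ⟨n - j - 1, by omega⟩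
  have e := Nat.choose_succ_right_eq (j + (m + 1)) j
  rw [show j + (m + 1) - j = m + 1 by omega] at e ⊢
  rw [show j + (m + 1) - (j + 1) = m by omega]
  have hX : 2 ≤ 2 ^ m := Nat.le_self_pow (by omega) 2
  obtain ⟨X, hX'⟩ : ∃ X, 2 ^ m = X + 2 := ⟨2 ^ m - 2, by omega⟩
  rw [pow_succ, hX']
  have : (X + 2) * 2 - 2 = 2 * X + 2 := by omega
  rw [this, Nat.add_sub_cancel]
  refine Nat.le_of_mul_le_mul_right (c := j + 1) ?_ (by omega)
  calc _ = (j + (m + 1)).choose j * ((m + 1) * X) := by rw [← mul_assoc, ← e]; ring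
    _ ≤ (j + (m + 1)).choose j * (2 * (j + 1) * (X + 1)) := by
        refine Nat.mul_le_mul_left _ ?_
        exact Nat.mul_le_mul (by omega) (by omega)
    _ = _ := by ring

/-- The level of total size `n - n / 3` is the largest one. -/
lemma choose_mul_le_middle {n j : ℕ} (hn : 2 ≤ n) (hj : j < n) :
    n.choose j * (2 ^ (n - j) - 2) ≤ n.choose (n / 3) * (2 ^ (n - n / 3) - 2) := by
  rcases le_total j (n / 3) with h | h
  · induction h using Nat.decreasingInduction with
    | self => exact le_rfl
    | of_succ k hk ih => exact (choose_mul_le_of_lt_third (by omega)).trans (ih (by omega))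
  · induction j, h using Nat.le_induction with
    | base => exact le_rfl
    | succ k hk ih => exact (choose_mul_le_of_third_le (by omega) hj).trans (ih (by omega))

lemma pairLevel_le {n m : ℕ} (hm : 2 ≤ m) (hmn : m ≤ n) :
    pairLevel n m ≤ 2 * ((n.choose (n / 3) * (2 ^ (n - n / 3 - 1) - 1) : ℕ) : ℝ) := by
  have h := choose_mul_le_middle (hm.trans hmn) (show n - m < n by omega)
  rw [show n - (n - m) = m by omega, Nat.choose_symm hmn] at h
  have e : 2 ^ (n - n / 3) - 2 = 2 * (2 ^ (n - n / 3 - 1) - 1) := by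
    obtain ⟨k, hk⟩ : ∃ k, n - n / 3 = k + 1 := ⟨n - n / 3 - 1, by omega⟩
    rw [hk, pow_succ, Nat.add_sub_cancel]; omega
  rw [e, mul_left_comm] at h
  have h2 : 2 ≤ 2 ^ m := Nat.le_self_pow (by omega) 2
  have h' : ((n.choose m * (2 ^ m - 2) : ℕ) : ℝ)
      ≤ ((2 * (n.choose (n / 3) * (2 ^ (n - n / 3 - 1) - 1)) : ℕ) : ℝ) := by exact_mod_cast h
  rw [Nat.cast_mul 2, Nat.cast_mul, Nat.cast_sub h2] at h'
  rw [pairLevel]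
  exact_mod_cast h'

/-- Ordered pairs of disjoint nonempty sets. -/
def IsDisjointPair {n : ℕ} (x : Finset (Fin n) × Finset (Fin n)) : Prop :=
  Disjoint x.1 x.2 ∧ x.1.Nonempty ∧ x.2.Nonempty

lemma sum_le_sum_of_injOn_support {ι κ : Type*} {s : Finset ι} {t : Finset κ}
    {f : ι → ℝ} {g : κ → ℝ} (i : ι → κ) (hi : ∀ a ∈ s, f a ≠ 0 → i a ∈ t)
    (inj : Set.InjOn i s) (hfg : ∀ a ∈ s, f a = g (i a)) (hg : ∀ x ∈ t, 0 ≤ g x) :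
    ∑ a ∈ s, f a ≤ ∑ x ∈ t, g x := by
  classical
  rw [← Finset.sum_filter_ne_zero]
  calc _ = ∑ a ∈ s with f a ≠ 0, g (i a) :=
        Finset.sum_congr rfl fun a ha => hfg a (Finset.mem_filter.1 ha).1
    _ = ∑ x ∈ (s.filter fun a => f a ≠ 0).image i, g x := by
        rw [Finset.sum_image]
        exact inj.mono fun a ha => (Finset.mem_filter.1 ha).1
    _ ≤ _ := by
        refine Finset.sum_le_sum_of_subset_of_nonneg ?_ fun x hx _ => hg x hx
        intro x hx
        obtain ⟨a, ha, rfl⟩ := Finset.mem_image.1 hx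
        exact hi a (Finset.mem_filter.1 ha).1 (Finset.mem_filter.1 ha).2

lemma sum_erase_fst_le {n : ℕ} {D X : Finset (Finset (Fin n) × Finset (Fin n))}
    {φ : Finset (Fin n) × Finset (Fin n) → ℝ} (hφ : ∀ x ∈ X, 0 ≤ φ x)
    (hD : ∀ y ∈ D, Disjoint y.1 y.2)
    (h : ∀ y ∈ D, ∀ e ∈ y.1, φ (y.1.erase e, y.2) ≠ 0 → (y.1.erase e, y.2) ∈ X) :
    ∑ y ∈ D, ∑ e ∈ y.1, φ (y.1.erase e, y.2) ≤ ∑ x ∈ X, ∑ _e ∈ (x.1 ∪ x.2)ᶜ, φ x := by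
  rw [Finset.sum_sigma', Finset.sum_sigma']
  refine sum_le_sum_of_injOn_support (fun z => ⟨(z.1.1.erase z.2, z.1.2), z.2⟩) ?_ ?_
    (fun _ _ => rfl) fun z hz => hφ _ (Finset.mem_sigma.1 hz).1
  · rintro ⟨y, e⟩ hz hne
    obtain ⟨hy, he⟩ := Finset.mem_sigma.1 hz
    refine Finset.mem_sigma.2 ⟨h y hy e he hne, ?_⟩
    simpa using Finset.disjoint_left.1 (hD y hy) he
  · rintro ⟨⟨S, T⟩, e⟩ hz ⟨⟨S', T'⟩, e'⟩ hz' heq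
    have he : e ∈ S := (Finset.mem_sigma.1 hz).2
    have he' : e' ∈ S' := (Finset.mem_sigma.1 hz').2
    simp only [Sigma.mk.injEq, Prod.mk.injEq, heq_eq_eq] at heq
    obtain ⟨⟨h1, rfl⟩, rfl⟩ := heq
    rw [← Finset.insert_erase he, h1, Finset.insert_erase he']

lemma sum_erase_snd_le {n : ℕ} {D X : Finset (Finset (Fin n) × Finset (Fin n))}
    {φ : Finset (Fin n) × Finset (Fin n) → ℝ} (hφ : ∀ x ∈ X, 0 ≤ φ x)
    (hD : ∀ y ∈ D, Disjoint y.1 y.2)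
    (h : ∀ y ∈ D, ∀ e ∈ y.2, φ (y.1, y.2.erase e) ≠ 0 → (y.1, y.2.erase e) ∈ X) :
    ∑ y ∈ D, ∑ e ∈ y.2, φ (y.1, y.2.erase e) ≤ ∑ x ∈ X, ∑ _e ∈ (x.1 ∪ x.2)ᶜ, φ x := by
  rw [Finset.sum_sigma', Finset.sum_sigma']
  refine sum_le_sum_of_injOn_support (fun z => ⟨(z.1.1, z.1.2.erase z.2), z.2⟩) ?_ ?_
    (fun _ _ => rfl) fun z hz => hφ _ (Finset.mem_sigma.1 hz).1
  · rintro ⟨y, e⟩ hz hne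
    obtain ⟨hy, he⟩ := Finset.mem_sigma.1 hz
    refine Finset.mem_sigma.2 ⟨h y hy e he hne, ?_⟩
    simpa using Finset.disjoint_right.1 (hD y hy) he
  · rintro ⟨⟨S, T⟩, e⟩ hz ⟨⟨S', T'⟩, e'⟩ hz' heq
    have he : e ∈ T := (Finset.mem_sigma.1 hz).2
    have he' : e' ∈ T' := (Finset.mem_sigma.1 hz').2
    simp only [Sigma.mk.injEq, Prod.mk.injEq, heq_eq_eq] at heq
    obtain ⟨⟨rfl, h1⟩, rfl⟩ := heq
    rw [← Finset.insert_erase he, h1, Finset.insert_erase he']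

/-- The normalized matching property for ordered disjoint pairs. -/
lemma card_div_pairLevel_le {n m : ℕ} (hm : 2 ≤ m)
    {D X : Finset (Finset (Fin n) × Finset (Fin n))}
    (hD : ∀ y ∈ D, IsDisjointPair y ∧ y.1.card + y.2.card = m + 1)
    (hX : ∀ x, x ∈ X ↔ (IsDisjointPair x ∧ x.1.card + x.2.card = m) ∧ ∃ y ∈ D, x ≤ y) :
    D.card * (pairLevel n (m + 1))⁻¹ ≤ X.card * (pairLevel n m)⁻¹ := by
  rcases D.eq_empty_or_nonempty with rfl | ⟨y₀, hy₀⟩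
  · have : X = ∅ := by
      ext x; simp [hX]
    simp [this]
  have hmn : m < n := by
    have h1 := hD y₀ hy₀
    have h2 := Finset.card_union_of_disjoint h1.1.1
    have h3 := Finset.card_le_univ (y₀.1 ∪ y₀.2)
    rw [Fintype.card_fin] at h3
    omega
  obtain ⟨u, v, hu, hv, hu0, hvm, hout, hin⟩ := exists_flow hm hmn
  have hXp : ∀ x ∈ X, 1 ≤ x.1.card ∧ x.1.card ≤ m := by
    intro x hx
    obtain ⟨⟨hx1, hx2⟩, -⟩ := (hX x).1 hx
    have := hx1.2.1.card_pos
    omega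
  have hdis : ∀ y ∈ D, Disjoint y.1 y.2 := fun y hy => (hD y hy).1.1
  have k1 := sum_erase_fst_le (D := D) (X := X) (φ := fun x => u x.1.card)
    (fun x hx => hu _ (hXp x hx).2) hdis (by
      intro y hy e he hne
      obtain ⟨⟨h1, h2, h3⟩, h4⟩ := hD y hy
      have hc := Finset.card_erase_of_mem he
      have hp := h2.card_pos
      refine (hX _).2 ⟨⟨⟨h1.mono_left (Finset.erase_subset _ _), ?_, h3⟩, ?_⟩, y, hy,
        Finset.erase_subset _ _, le_rfl⟩
      · rw [Finset.nonempty_iff_ne_empty]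
        intro h0
        refine hne ?_
        simp only at h0 ⊢
        rw [h0, Finset.card_empty, hu0]
      · simp only; omega)
  have k2 := sum_erase_snd_le (D := D) (X := X) (φ := fun x => v x.1.card)
    (fun x hx => hv _ (hXp x hx).1 (hXp x hx).2) hdis (by
      intro y hy e he hne
      obtain ⟨⟨h1, h2, h3⟩, h4⟩ := hD y hy
      have hc := Finset.card_erase_of_mem he
      have hp := h3.card_pos
      refine (hX _).2 ⟨⟨⟨h1.mono_right (Finset.erase_subset _ _), h2, ?_⟩, ?_⟩, y, hy,
        le_rfl, Finset.erase_subset _ _⟩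
      · rw [← Finset.card_pos]
        simp only
        by_contra h0
        refine hne ?_
        simp only
        rw [show y.1.card = m by omega, hvm]
      · simp only; omega)
  have k3 : ∀ y ∈ D, (pairLevel n (m + 1))⁻¹ =
      ∑ e ∈ y.1, u (y.1.erase e).card + ∑ e ∈ y.2, v y.1.card := by
    intro y hy
    obtain ⟨⟨h1, h2, h3⟩, h4⟩ := hD y hy
    rw [Finset.sum_congr rfl fun e he => by rw [Finset.card_erase_of_mem he]]
    rw [Finset.sum_const, Finset.sum_const, nsmul_eq_mul, nsmul_eq_mul]
    exact (hin _ _ h2.card_pos h3.card_pos h4).symm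
  have k4 : ∀ x ∈ X, ∑ _e ∈ (x.1 ∪ x.2)ᶜ, u x.1.card + ∑ _e ∈ (x.1 ∪ x.2)ᶜ, v x.1.card =
      (pairLevel n m)⁻¹ := by
    intro x hx
    obtain ⟨⟨⟨h1, h2, h3⟩, h4⟩, -⟩ := (hX x).1 hx
    rw [← Finset.sum_add_distrib, Finset.sum_const, nsmul_eq_mul, Finset.card_compl,
      Finset.card_union_of_disjoint h1, h4, Fintype.card_fin, Nat.cast_sub hmn.le]
    exact hout _ (hXp x hx).1 (hXp x hx).2
  calc _ = ∑ y ∈ D, (pairLevel n (m + 1))⁻¹ := by simp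
    _ = ∑ y ∈ D, ∑ e ∈ y.1, u (y.1.erase e).card + ∑ y ∈ D, ∑ e ∈ y.2, v y.1.card := by
        rw [← Finset.sum_add_distrib]; exact Finset.sum_congr rfl k3
    _ ≤ ∑ x ∈ X, ∑ _e ∈ (x.1 ∪ x.2)ᶜ, u x.1.card + ∑ x ∈ X, ∑ _e ∈ (x.1 ∪ x.2)ᶜ, v x.1.card :=
        add_le_add k1 k2
    _ = ∑ x ∈ X, (pairLevel n m)⁻¹ := by
        rw [← Finset.sum_add_distrib]; exact Finset.sum_congr rfl k4
    _ = _ := by simp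

lemma card_add_card_le {n : ℕ} {x : Finset (Fin n) × Finset (Fin n)} (hx : IsDisjointPair x) :
    2 ≤ x.1.card + x.2.card ∧ x.1.card + x.2.card ≤ n := by
  have h2 := Finset.card_union_of_disjoint hx.1
  have h3 := Finset.card_le_univ (x.1 ∪ x.2)
  rw [Fintype.card_fin] at h3
  have := hx.2.1.card_pos
  have := hx.2.2.card_pos
  omega

lemma sum_pairLevel_inv_le_card {n : ℕ} {A : Finset (Finset (Fin n) × Finset (Fin n))}
    (hA : ∀ x ∈ A, IsDisjointPair x)
    (hanti : IsAntichain (· ≤ ·) (A : Set (Finset (Fin n) × Finset (Fin n))))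
    {m : ℕ} (hm : 2 ≤ m) (hmn : m ≤ n + 1) (X : Finset (Finset (Fin n) × Finset (Fin n)))
    (hX : ∀ x, x ∈ X ↔ (IsDisjointPair x ∧ x.1.card + x.2.card = m) ∧ ∃ y ∈ A, x ≤ y) :
    ∑ x ∈ A with m ≤ x.1.card + x.2.card, (pairLevel n (x.1.card + x.2.card))⁻¹ ≤
      X.card * (pairLevel n m)⁻¹ := by
  classical
  induction hmn using Nat.decreasingInduction generalizing X with
  | self =>
    have : (A.filter fun x => n + 1 ≤ x.1.card + x.2.card) = ∅ := by
      refine Finset.filter_eq_empty_iff.2 fun x hx => ?_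
      have := card_add_card_le (hA x hx)
      omega
    have h0 : X = ∅ := by
      refine Finset.eq_empty_of_forall_notMem fun x hx => ?_
      have h := (hX x).1 hx
      have := card_add_card_le h.1.1
      omega
    rw [this, h0]; simp
  | of_succ m hmn ih =>
    let D := Finset.univ.filter fun x : Finset (Fin n) × Finset (Fin n) =>
      (IsDisjointPair x ∧ x.1.card + x.2.card = m + 1) ∧ ∃ y ∈ A, x ≤ y
    let E := Finset.univ.filter fun x : Finset (Fin n) × Finset (Fin n) =>
      (IsDisjointPair x ∧ x.1.card + x.2.card = m) ∧ ∃ y ∈ D, x ≤ y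
    have h1 := ih (by omega) D (by simp [D])
    have h2 := card_div_pairLevel_le (n := n) hm (D := D) (X := E)
      (fun y hy => (Finset.mem_filter.1 hy).2.1) (by simp [E])
    have hsplit : (A.filter fun x => m ≤ x.1.card + x.2.card) =
        (A.filter fun x => x.1.card + x.2.card = m) ∪
          (A.filter fun x => m + 1 ≤ x.1.card + x.2.card) := by
      ext x; simp only [Finset.mem_filter, Finset.mem_union]; grind
    rw [hsplit, Finset.sum_union]
    · have h3 : (A.filter fun x => x.1.card + x.2.card = m).card + E.card ≤ X.card := by
        rw [← Finset.card_union_of_disjoint]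
        · refine Finset.card_le_card (Finset.union_subset ?_ ?_)
          · intro x hx
            obtain ⟨hx, hxm⟩ := Finset.mem_filter.1 hx
            exact (hX x).2 ⟨⟨hA x hx, hxm⟩, x, hx, le_rfl⟩
          · intro x hx
            obtain ⟨-, hx, y, hy, hxy⟩ := Finset.mem_filter.1 hx
            obtain ⟨-, -, z, hz, hyz⟩ := Finset.mem_filter.1 hy
            exact (hX x).2 ⟨hx, z, hz, hxy.trans hyz⟩
        · refine Finset.disjoint_left.2 fun x hx hx' => ?_
          obtain ⟨hx, hxm⟩ := Finset.mem_filter.1 hx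
          obtain ⟨-, -, y, hy, hxy⟩ := Finset.mem_filter.1 hx'
          obtain ⟨-, ⟨-, hym⟩, z, hz, hyz⟩ := Finset.mem_filter.1 hy
          have e := hanti.eq hx hz (hxy.trans hyz)
          subst e
          rw [le_antisymm hxy hyz] at hxm
          omega
      have h4 : ∑ x ∈ A with x.1.card + x.2.card = m, (pairLevel n (x.1.card + x.2.card))⁻¹ =
          (A.filter fun x => x.1.card + x.2.card = m).card * (pairLevel n m)⁻¹ := by
        rw [← nsmul_eq_mul, ← Finset.sum_const]
        exact Finset.sum_congr rfl fun x hx => by rw [(Finset.mem_filter.1 hx).2]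
      have h5 : (((A.filter fun x => x.1.card + x.2.card = m).card : ℝ) + E.card) ≤ X.card := by
        exact_mod_cast h3
      have h6 := pairLevel_pos hm (show m ≤ n by omega)
      have h7 := mul_le_mul_of_nonneg_right h5 (inv_pos.2 h6).le
      rw [h4]
      linarith
    · refine Finset.disjoint_left.2 fun x hx hx' => ?_
      have h8 := (Finset.mem_filter.1 hx).2
      have h9 := (Finset.mem_filter.1 hx').2
      omega

lemma card_le_pairLevel_two {n : ℕ} {X : Finset (Finset (Fin n) × Finset (Fin n))}
    (hX : ∀ x ∈ X, IsDisjointPair x ∧ x.1.card + x.2.card = 2) :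
    (X.card : ℝ) ≤ pairLevel n 2 := by
  classical
  have h : X ⊆ (Finset.univ : Finset (Fin n)).offDiag.image fun z => ({z.1}, {z.2}) := by
    rintro ⟨S, T⟩ hx
    obtain ⟨⟨h1, h2, h3⟩, h4⟩ := hX _ hx
    have := h2.card_pos
    have := h3.card_pos
    simp only at *
    obtain ⟨i, rfl⟩ := Finset.card_eq_one.1 (show S.card = 1 by omega)
    obtain ⟨j, rfl⟩ := Finset.card_eq_one.1 (show T.card = 1 by omega)
    exact Finset.mem_image.2 ⟨(i, j), by simpa using h1, rfl⟩
  have h' := (Finset.card_le_card h).trans Finset.card_image_le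
  rw [Finset.offDiag_card, Finset.card_univ, Fintype.card_fin] at h'
  have h2 : (X.card : ℝ) ≤ n * n - n := by
    rw [le_sub_iff_add_le]
    have : X.card + n ≤ n * n := by
      have := Nat.le_mul_self n
      omega
    exact_mod_cast this
  rw [pairLevel, Nat.cast_choose_two]
  linarith

/-- The LYM inequality for antichains of ordered disjoint pairs. -/
lemma sum_pairLevel_inv_le_one {n : ℕ} (hn : 2 ≤ n)
    {A : Finset (Finset (Fin n) × Finset (Fin n))} (hA : ∀ x ∈ A, IsDisjointPair x)
    (hanti : IsAntichain (· ≤ ·) (A : Set (Finset (Fin n) × Finset (Fin n)))) :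
    ∑ x ∈ A, (pairLevel n (x.1.card + x.2.card))⁻¹ ≤ 1 := by
  classical
  have h := sum_pairLevel_inv_le_card hA hanti le_rfl (by omega)
    (Finset.univ.filter fun x => (IsDisjointPair x ∧ x.1.card + x.2.card = 2) ∧ ∃ y ∈ A, x ≤ y)
    (by simp)
  rw [Finset.filter_true_of_mem fun x hx => (card_add_card_le (hA x hx)).1] at h
  refine h.trans ?_
  rw [← div_eq_mul_inv, div_le_one (pairLevel_pos le_rfl hn)]
  exact card_le_pairLevel_two fun x hx => (Finset.mem_filter.1 hx).2.1

/-- Sperner-type bound for antichains of ordered disjoint pairs. -/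
lemma card_antichain_le {n : ℕ} (hn : 2 ≤ n)
    {A : Finset (Finset (Fin n) × Finset (Fin n))} (hA : ∀ x ∈ A, IsDisjointPair x)
    (hanti : IsAntichain (· ≤ ·) (A : Set (Finset (Fin n) × Finset (Fin n)))) :
    A.card ≤ 2 * (n.choose (n / 3) * (2 ^ (n - n / 3 - 1) - 1)) := by
  rcases A.eq_empty_or_nonempty with rfl | ⟨x₀, hx₀⟩
  · simp
  set M : ℝ := 2 * ((n.choose (n / 3) * (2 ^ (n - n / 3 - 1) - 1) : ℕ) : ℝ) with hM
  have hle : ∀ x ∈ A, pairLevel n (x.1.card + x.2.card) ≤ M ∧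
      0 < pairLevel n (x.1.card + x.2.card) := fun x hx =>
    have h := card_add_card_le (hA x hx)
    ⟨pairLevel_le h.1 h.2, pairLevel_pos h.1 h.2⟩
  have hM0 : 0 < M := (hle x₀ hx₀).2.trans_le (hle x₀ hx₀).1
  have h1 : (A.card : ℝ) * M⁻¹ ≤ 1 := by
    refine le_trans ?_ (sum_pairLevel_inv_le_one hn hA hanti)
    rw [← nsmul_eq_mul, ← Finset.sum_const]
    exact Finset.sum_le_sum fun x hx => inv_anti₀ (hle x hx).2 (hle x hx).1
  rw [← div_eq_mul_inv, div_le_one hM0, hM] at h1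
  exact_mod_cast h1

/-- A shortest cycle of a relation which is compatible with a preorder is an antichain. -/
lemma exists_antichain_cycle {α : Type*} {r le : α → α → Prop}
    (hr : ∀ x x' y z, le x x' → r x' y → r x z → r x y)
    (h : ∃ p, 1 ≤ p ∧ ∃ P : ℕ → α, (∀ k < p, r (P k) (P (k + 1))) ∧ le (P p) (P 0)) :
    ∃ p, 1 ≤ p ∧ ∃ P : ℕ → α, ((∀ k < p, r (P k) (P (k + 1))) ∧ le (P p) (P 0)) ∧
      ∀ i j, i < j → j < p → ¬ le (P i) (P j) ∧ ¬ le (P j) (P i) := by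
  classical
  obtain ⟨hp, P, hP, hP0⟩ := Nat.find_spec h
  have hmin := fun q (hq : q < Nat.find h) => Nat.find_min h hq
  generalize Nat.find h = p at hp hP hP0 hmin
  refine ⟨p, hp, P, ⟨hP, hP0⟩, fun i j hij hjp => ⟨fun hle => ?_, fun hle => ?_⟩⟩
  · refine hmin (p - (j - i)) (by omega) ⟨by omega,
      fun k => if k ≤ i then P k else P (k + (j - i)), fun k hk => ?_, ?_⟩
    · rcases lt_trichotomy k i with hki | rfl | hki
      · simp only [hki.le, Nat.succ_le_of_lt hki, if_true]
        exact hP k (by omega)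
      · simp only [le_refl, if_true, show ¬ k + 1 ≤ k by omega, if_false]
        rw [show k + 1 + (j - k) = j + 1 by omega]
        exact hr _ _ _ _ hle (hP j hjp) (hP k (by omega))
      · simp only [show ¬ k ≤ i by omega, show ¬ k + 1 ≤ i by omega, if_false]
        rw [show k + 1 + (j - i) = k + (j - i) + 1 by omega]
        exact hP _ (by omega)
    · simp only [show ¬ p - (j - i) ≤ i by omega, if_false, Nat.zero_le, if_true]
      rwa [show p - (j - i) + (j - i) = p by omega]
  · refine hmin (j - i) (by omega) ⟨by omega, fun k => P (i + k), fun k hk => ?_, ?_⟩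
    · exact hP (i + k) (by omega)
    · simpa only [show i + (j - i) = j by omega, add_zero] using hle

/-- Inclusion of pairs of sets, regardless of the order of the two components. -/
def PairLE {n : ℕ} (x y : Finset (Fin n) × Finset (Fin n)) : Prop := x ≤ y ∨ x ≤ y.swap

lemma PairLE.trans {n : ℕ} {x y z : Finset (Fin n) × Finset (Fin n)}
    (hxy : PairLE x y) (hyz : PairLE y z) : PairLE x z := by
  rcases hxy with hxy | hxy <;> rcases hyz with hyz | hyz
  · exact Or.inl (hxy.trans hyz)
  · exact Or.inr (hxy.trans hyz)
  · exact Or.inr (hxy.trans (Prod.swap_le_swap.2 hyz))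
  · exact Or.inl (hxy.trans (by simpa using Prod.swap_le_swap.2 hyz))

lemma IsDisjointPair.swap {n : ℕ} {x : Finset (Fin n) × Finset (Fin n)}
    (hx : IsDisjointPair x) : IsDisjointPair x.swap :=
  ⟨hx.1.symm, hx.2.2, hx.2.1⟩

lemma IsDisjointPair.not_le_swap {n : ℕ} {x : Finset (Fin n) × Finset (Fin n)}
    (hx : IsDisjointPair x) : ¬ x ≤ x.swap := by
  intro h
  obtain ⟨i, hi⟩ := hx.2.1
  exact Finset.disjoint_left.1 hx.1 hi (h.1 hi)

/-- Sperner-type bound for unordered antichains of disjoint pairs. -/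
lemma length_le_of_antichain {n p : ℕ} (hn : 2 ≤ n) {P : ℕ → Finset (Fin n) × Finset (Fin n)}
    (hP : ∀ k < p, IsDisjointPair (P k))
    (hanti : ∀ i j, i < j → j < p → ¬ PairLE (P i) (P j) ∧ ¬ PairLE (P j) (P i)) :
    p ≤ pstar n := by
  classical
  let f : Fin p × Bool → Finset (Fin n) × Finset (Fin n) := fun z =>
    if z.2 then (P z.1).swap else P z.1
  have hf : ∀ z w, f z ≤ f w → z = w := by
    rintro ⟨i, b⟩ ⟨j, c⟩ hle
    have hPL : PairLE (P i) (P j) := by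
      cases b <;> cases c <;> simp only [f, if_true, Bool.false_eq_true, if_false] at hle
      · exact Or.inl hle
      · exact Or.inr hle
      · exact Or.inr (by simpa using Prod.swap_le_swap.2 hle)
      · exact Or.inl (Prod.swap_le_swap.1 hle)
    have hij : i = j := by
      rcases lt_trichotomy i j with h | h | h
      · exact absurd hPL (hanti i j h j.2).1
      · exact h
      · exact absurd hPL (hanti j i h i.2).2
    subst hij
    have hd := hP i i.2
    cases b <;> cases c <;> simp only [f, if_true, Bool.false_eq_true, if_false] at hle
    · rfl
    · exact absurd hle hd.not_le_swap
    · exact absurd hle (by simpa using hd.swap.not_le_swap)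
    · rfl
  have hinj : Function.Injective f := fun z w h => hf z w h.le
  have hcard := card_antichain_le hn (A := Finset.univ.image f) (by
      intro x hx
      obtain ⟨⟨i, b⟩, -, rfl⟩ := Finset.mem_image.1 hx
      have := hP i i.2
      cases b
      · simpa [f] using this
      · simpa [f] using this.swap) (by
      intro x hx y hy hne hle
      obtain ⟨z, -, rfl⟩ := Finset.mem_image.1 (Finset.mem_coe.1 hx)
      obtain ⟨w, -, rfl⟩ := Finset.mem_image.1 (Finset.mem_coe.1 hy)
      exact hne (congrArg f (hf z w hle)))
  rw [Finset.card_image_of_injective _ hinj, Finset.card_univ, Fintype.card_prod,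
    Fintype.card_fin, Fintype.card_bool] at hcard
  rw [pstar]
  omega

lemma IsStochastic.one {n : ℕ} : IsStochastic (1 : Matrix (Fin n) (Fin n) ℝ) := by
  refine ⟨fun i j => ?_, fun i => ?_⟩
  · rw [Matrix.one_apply]; split_ifs <;> norm_num
  · simp [Matrix.one_apply]

lemma IsStochastic.mul {n : ℕ} {A B : Matrix (Fin n) (Fin n) ℝ} (hA : IsStochastic A)
    (hB : IsStochastic B) : IsStochastic (A * B) := by
  refine ⟨fun i j => ?_, fun i => ?_⟩
  · rw [Matrix.mul_apply]
    exact Finset.sum_nonneg fun k _ => mul_nonneg (hA.1 _ _) (hB.1 _ _)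
  · simp only [Matrix.mul_apply]
    rw [Finset.sum_comm]
    simp only [← Finset.mul_sum, hB.2, mul_one, hA.2]

lemma IsStochastic.pow {n : ℕ} {A : Matrix (Fin n) (Fin n) ℝ} (hA : IsStochastic A) (t : ℕ) :
    IsStochastic (A ^ t) := by
  induction t with
  | zero => rw [pow_zero]; exact .one
  | succ t ih => rw [pow_succ]; exact ih.mul hA

/-- The product `A 0 * A 1 * ⋯ * A (k - 1)`. -/
def fwdProd {n : ℕ} (A : ℕ → Matrix (Fin n) (Fin n) ℝ) : ℕ → Matrix (Fin n) (Fin n) ℝ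
  | 0 => 1
  | k + 1 => fwdProd A k * A k

lemma fwdProd_succ' {n : ℕ} (A : ℕ → Matrix (Fin n) (Fin n) ℝ) (k : ℕ) :
    fwdProd A (k + 1) = A 0 * fwdProd (fun i => A (i + 1)) k := by
  induction k with
  | zero => simp [fwdProd]
  | succ k ih => rw [fwdProd, ih, fwdProd, mul_assoc]

lemma prod_ofFn_eq_fwdProd {n : ℕ} (A : ℕ → Matrix (Fin n) (Fin n) ℝ) (k : ℕ) :
    (List.ofFn fun i : Fin k => A i).prod = fwdProd A k := by
  induction k with
  | zero => simp [fwdProd]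
  | succ k ih =>
    rw [List.ofFn_succ', List.concat_eq_append, List.prod_append, List.prod_singleton,
      fwdProd, ← ih]
    rfl

lemma partialProd_add {n : ℕ} (σ : ℕ → Matrix (Fin n) (Fin n) ℝ) (s k : ℕ) :
    partialProd σ (s + k) = fwdProd (fun i => σ (s + k - i)) k * partialProd σ s := by
  induction k with
  | zero => simp [fwdProd]
  | succ k ih =>
    rw [← add_assoc, partialProd, ih, fwdProd_succ', mul_assoc]
    congr 3
    funext i
    congr 1
    omega

lemma IsStochastic.fwdProd {n : ℕ} {A : ℕ → Matrix (Fin n) (Fin n) ℝ} {k : ℕ}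
    (hA : ∀ i < k, IsStochastic (A i)) : IsStochastic (fwdProd A k) := by
  induction k with
  | zero => exact .one
  | succ k ih => exact (ih fun i hi => hA i (by omega)).mul (hA k (by omega))

lemma IsStochastic.partialProd {n : ℕ} {σ : ℕ → Matrix (Fin n) (Fin n) ℝ}
    (hσ : ∀ t, IsStochastic (σ t)) (t : ℕ) : IsStochastic (partialProd σ t) := by
  induction t with
  | zero => exact .one
  | succ t ih => exact (hσ _).mul ih

open Classical in
/-- The set of indices reachable in one step from `S` in the graph of `A`. -/
noncomputable def post {n : ℕ} (A : Matrix (Fin n) (Fin n) ℝ) (S : Finset (Fin n)) :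
    Finset (Fin n) :=
  Finset.univ.filter fun j => ∃ i ∈ S, 0 < A i j

lemma mem_post {n : ℕ} {A : Matrix (Fin n) (Fin n) ℝ} {S : Finset (Fin n)} {j : Fin n} :
    j ∈ post A S ↔ ∃ i ∈ S, 0 < A i j := by simp [post]

lemma post_mono {n : ℕ} (A : Matrix (Fin n) (Fin n) ℝ) {S T : Finset (Fin n)} (h : S ⊆ T) :
    post A S ⊆ post A T := by
  intro j hj
  obtain ⟨i, hi, hA⟩ := mem_post.1 hj
  exact mem_post.2 ⟨i, h hi, hA⟩

lemma post_one {n : ℕ} (S : Finset (Fin n)) : post 1 S = S := by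
  ext j
  simp only [mem_post, Matrix.one_apply]
  constructor
  · rintro ⟨i, hi, h⟩
    split_ifs at h with hij
    · exact hij ▸ hi
    · exact absurd h (lt_irrefl 0)
  · exact fun hj => ⟨j, hj, by simp⟩

lemma mul_apply_pos_iff {n : ℕ} {A B : Matrix (Fin n) (Fin n) ℝ} (hA : IsStochastic A)
    (hB : IsStochastic B) {i j : Fin n} : 0 < (A * B) i j ↔ ∃ k, 0 < A i k ∧ 0 < B k j := by
  rw [Matrix.mul_apply,
    Finset.sum_pos_iff_of_nonneg fun k _ => mul_nonneg (hA.1 i k) (hB.1 k j)]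
  simp only [Finset.mem_univ, true_and]
  refine exists_congr fun k => ⟨fun h => ?_, fun h => mul_pos h.1 h.2⟩
  exact ⟨pos_of_mul_pos_left h (hB.1 k j), pos_of_mul_pos_right h (hA.1 i k)⟩

lemma post_mul {n : ℕ} {A B : Matrix (Fin n) (Fin n) ℝ} (hA : IsStochastic A)
    (hB : IsStochastic B) (S : Finset (Fin n)) : post (A * B) S = post B (post A S) := by
  ext j
  simp only [mem_post, mul_apply_pos_iff hA hB]
  grind

lemma IsStochastic.exists_pos {n : ℕ} {A : Matrix (Fin n) (Fin n) ℝ} (hA : IsStochastic A)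
    (i : Fin n) : ∃ j, 0 < A i j := by
  by_contra! h
  have h1 := hA.2 i
  have h2 : ∑ j, A i j ≤ 0 := Finset.sum_nonpos fun j _ => h j
  linarith

lemma post_nonempty {n : ℕ} {A : Matrix (Fin n) (Fin n) ℝ} (hA : IsStochastic A)
    {S : Finset (Fin n)} (hS : S.Nonempty) : (post A S).Nonempty := by
  obtain ⟨i, hi⟩ := hS
  obtain ⟨j, hj⟩ := hA.exists_pos i
  exact ⟨j, mem_post.2 ⟨i, hi, hj⟩⟩

lemma disjoint_of_disjoint_post {n : ℕ} {A : Matrix (Fin n) (Fin n) ℝ} (hA : IsStochastic A)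
    {S T : Finset (Fin n)} (h : Disjoint (post A S) (post A T)) : Disjoint S T := by
  refine Finset.disjoint_left.2 fun i hS hT => ?_
  obtain ⟨j, hj⟩ := hA.exists_pos i
  exact Finset.disjoint_left.1 h (mem_post.2 ⟨i, hS, hj⟩) (mem_post.2 ⟨i, hT, hj⟩)

/-- The componentwise image of a pair of sets under `post`. -/
noncomputable def postPair {n : ℕ} (A : Matrix (Fin n) (Fin n) ℝ)
    (x : Finset (Fin n) × Finset (Fin n)) : Finset (Fin n) × Finset (Fin n) :=
  (post A x.1, post A x.2)

lemma postPair_mono {n : ℕ} (A : Matrix (Fin n) (Fin n) ℝ)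
    {x y : Finset (Fin n) × Finset (Fin n)} (h : x ≤ y) : postPair A x ≤ postPair A y :=
  ⟨post_mono A h.1, post_mono A h.2⟩

lemma PairLE.postPair {n : ℕ} (A : Matrix (Fin n) (Fin n) ℝ)
    {x y : Finset (Fin n) × Finset (Fin n)} (h : PairLE x y) :
    PairLE (postPair A x) (postPair A y) :=
  h.imp (postPair_mono A) (postPair_mono A)

lemma postPair_mul {n : ℕ} {A B : Matrix (Fin n) (Fin n) ℝ} (hA : IsStochastic A)
    (hB : IsStochastic B) (x : Finset (Fin n) × Finset (Fin n)) :
    postPair (A * B) x = postPair B (postPair A x) := by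
  simp [_root_.postPair, post_mul hA hB]

/-- Two nonzero rows with disjoint supports force the rank to be at least two. -/
lemma rank_ne_one_of_disjoint_rows {n : ℕ} {L : Matrix (Fin n) (Fin n) ℝ} {i j k l : Fin n}
    (hik : L i k ≠ 0) (hjk : L j k = 0) (hjl : L j l ≠ 0) (hil : L i l = 0) : L.rank ≠ 1 := by
  intro h
  have hind : LinearIndependent ℝ (L.submatrix ![i, j] id).row := by
    rw [show (L.submatrix ![i, j] id).row = ![L i, L j] by
      funext a; fin_cases a <;> rfl]
    rw [LinearIndependent.pair_iff]
    intro s t hst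
    have h1 := congrFun hst k
    have h2 := congrFun hst l
    simp only [Pi.add_apply, Pi.smul_apply, smul_eq_mul, Pi.zero_apply, hjk, hil, mul_zero,
      add_zero, zero_add, mul_eq_zero, hik, hjl, or_false] at h1 h2
    exact ⟨h1, h2⟩
  have h1 := hind.rank_matrix
  have h2 := Matrix.rank_submatrix_le L ![i, j] id
  rw [h1, h, Fintype.card_fin] at h2
  omega

lemma apply_eq_zero_of_post_subset {n : ℕ} {R L : Matrix (Fin n) (Fin n) ℝ} (hR : IsStochastic R)
    {S : Finset (Fin n)} (hS : post R S ⊆ S)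
    (hL : ∀ i j, Tendsto (fun t => (R ^ t) i j) atTop (nhds (L i j)))
    {i j : Fin n} (hi : i ∈ S) (hj : j ∉ S) : L i j = 0 := by
  have hpow : ∀ t, post (R ^ t) S ⊆ S := by
    intro t
    induction t with
    | zero => rw [pow_zero, post_one]
    | succ t ih =>
      rw [pow_succ, post_mul (hR.pow t) hR]
      exact (post_mono R ih).trans hS
  have h0 : ∀ t, (R ^ t) i j = 0 := fun t =>
    le_antisymm (not_lt.1 fun h => hj (hpow t (mem_post.2 ⟨i, hi, h⟩))) ((hR.pow t).1 i j)
  have := hL i j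
  simp only [h0] at this
  exact tendsto_nhds_unique this tendsto_const_nhds

lemma sum_eq_one_of_tendsto {n : ℕ} {P : ℕ → Matrix (Fin n) (Fin n) ℝ}
    {L : Matrix (Fin n) (Fin n) ℝ} (hP : ∀ t, IsStochastic (P t))
    (hL : ∀ i j, Tendsto (fun t => P t i j) atTop (nhds (L i j))) (i : Fin n) :
    ∑ j, L i j = 1 := by
  have h := tendsto_finsetSum Finset.univ fun j _ => hL i j
  simp only [(hP _).2 i] at h
  exact tendsto_nhds_unique h tendsto_const_nhds

/-- A stochastic matrix preserving a disjoint pair does not have powers converging to rank one. -/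
lemma not_convergesToRankOne_pow {n : ℕ} {Q : Matrix (Fin n) (Fin n) ℝ} (hQ : IsStochastic Q)
    {x : Finset (Fin n) × Finset (Fin n)} (hx : IsDisjointPair x) (h : PairLE (postPair Q x) x) :
    ¬ ConvergesToRankOne fun t => Q ^ t := by
  rintro ⟨L, hrank, hL⟩
  have hRst := hQ.mul hQ
  have hR : postPair (Q * Q) x ≤ x := by
    rw [postPair_mul hQ hQ]
    rcases h with h | h
    · exact (postPair_mono Q h).trans h
    · exact (postPair_mono Q h).trans (Prod.swap_le_swap.2 h)
  have hRL : ∀ i j, Tendsto (fun t => ((Q * Q) ^ t) i j) atTop (nhds (L i j)) := by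
    intro i j
    have h2 : Tendsto (fun t : ℕ => 2 * t) atTop atTop :=
      tendsto_id.const_mul_atTop' (by norm_num)
    refine ((hL i j).comp h2).congr fun t => ?_
    simp only [Function.comp, pow_mul, pow_two]
  have hrow := sum_eq_one_of_tendsto (fun t => hQ.pow t) hL
  have hne : ∀ i, ∃ k, L i k ≠ 0 := by
    intro i
    obtain ⟨k, -, hk⟩ := Finset.exists_ne_zero_of_sum_ne_zero (by rw [hrow i]; exact one_ne_zero)
    exact ⟨k, hk⟩
  obtain ⟨hd, ⟨i, hi⟩, j, hj⟩ := hx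
  obtain ⟨k, hk⟩ := hne i
  obtain ⟨l, hl⟩ := hne j
  have hS := fun b => apply_eq_zero_of_post_subset (j := b) hRst hR.1 hRL hi
  have hT := fun b => apply_eq_zero_of_post_subset (j := b) hRst hR.2 hRL hj
  have hkS : k ∈ x.1 := by
    by_contra hc; exact hk (hS k hc)
  have hlT : l ∈ x.2 := by
    by_contra hc; exact hl (hT l hc)
  exact rank_ne_one_of_disjoint_rows hk (hT k (Finset.disjoint_left.1 hd hkS)) hl
    (hS l (Finset.disjoint_right.1 hd hlT)) hrank

/-- Transitions between disjoint pairs induced by a set of matrices. -/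
def PairStep {n : ℕ} (Sig : Finset (Matrix (Fin n) (Fin n) ℝ))
    (x y : Finset (Fin n) × Finset (Fin n)) : Prop :=
  IsDisjointPair x ∧ IsDisjointPair y ∧ ∃ A ∈ Sig, PairLE (postPair A x) y

/-- If powers of short products converge to rank one, then all long products are scrambling. -/
lemma exists_common_pos_of_short {n : ℕ} (hn : 2 ≤ n) {Sig : Finset (Matrix (Fin n) (Fin n) ℝ)}
    (hSig : ∀ A ∈ Sig, IsStochastic A)
    (h : ∀ p : ℕ, 1 ≤ p → p ≤ pstar n →
      ∀ B : Fin p → Matrix (Fin n) (Fin n) ℝ, (∀ i, B i ∈ Sig) →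
        ConvergesToRankOne (fun t => (List.ofFn B).prod ^ t))
    (A : ℕ → Matrix (Fin n) (Fin n) ℝ) (hA : ∀ k, A k ∈ Sig) (i j : Fin n) :
    ∃ k, 0 < fwdProd A (Fintype.card (Finset (Fin n) × Finset (Fin n))) i k ∧
      0 < fwdProd A (Fintype.card (Finset (Fin n) × Finset (Fin n))) j k := by
  by_contra hcon
  set N := Fintype.card (Finset (Fin n) × Finset (Fin n)) with hN
  have hst : ∀ k, IsStochastic (fwdProd A k) := fun k => .fwdProd fun i _ => hSig _ (hA i)
  let P : ℕ → Finset (Fin n) × Finset (Fin n) := fun k => postPair (fwdProd A k) ({i}, {j})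
  have hPs : ∀ k, P (k + 1) = postPair (A k) (P k) := fun k =>
    postPair_mul (hst k) (hSig _ (hA k)) _
  have hdis : ∀ k ≤ N, Disjoint (P k).1 (P k).2 := by
    intro k hk
    induction hk using Nat.decreasingInduction with
    | self =>
      refine Finset.disjoint_left.2 fun l hl hl' => hcon ⟨l, ?_⟩
      simpa [P, postPair, mem_post] using And.intro hl hl'
    | of_succ k hk ih =>
      rw [hPs] at ih
      exact disjoint_of_disjoint_post (hSig _ (hA k)) ih
  have hval : ∀ k ≤ N, IsDisjointPair (P k) := fun k hk =>
    ⟨hdis k hk, post_nonempty (hst k) (Finset.singleton_nonempty i),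
      post_nonempty (hst k) (Finset.singleton_nonempty j)⟩
  have hstep : ∀ k < N, PairStep Sig (P k) (P (k + 1)) := fun k hk =>
    ⟨hval k hk.le, hval (k + 1) hk, A k, hA k, Or.inl (hPs k).ge⟩
  have hcycle : ∃ k₁ k₂, k₁ < k₂ ∧ k₂ ≤ N ∧ P k₁ = P k₂ := by
    obtain ⟨a, b, hab, he⟩ := Fintype.exists_ne_map_eq_of_card_lt
      (fun k : Fin (N + 1) => P k) (by rw [Fintype.card_fin, ← hN]; omega)
    rcases lt_or_gt_of_ne hab with hlt | hlt
    · exact ⟨a, b, hlt, by omega, he⟩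
    · exact ⟨b, a, hlt, by omega, he.symm⟩
  obtain ⟨k₁, k₂, hlt, hk₂, he⟩ := hcycle
  obtain ⟨p, hp, R, ⟨hR, hR0⟩, hanti⟩ := exists_antichain_cycle (r := PairStep Sig) (le := PairLE)
    (fun x x' y z hle h1 h2 => by
      obtain ⟨-, hy, B, hB, hBy⟩ := h1
      exact ⟨h2.1, hy, B, hB, (hle.postPair B).trans hBy⟩)
    ⟨k₂ - k₁, by omega, fun k => P (k₁ + k), fun k hk => hstep _ (by omega), by
      simp only [show k₁ + (k₂ - k₁) = k₂ by omega, add_zero, he]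
      exact Or.inl le_rfl⟩
  have hpn := length_le_of_antichain hn (fun k hk => (hR k hk).1) hanti
  choose! B hB hle using fun k (hk : k < p) => (hR k hk).2.2
  have hBst : ∀ k < p, IsStochastic (B k) := fun k hk => hSig _ (hB k hk)
  have hpost : ∀ k ≤ p, PairLE (postPair (fwdProd B k) (R 0)) (R k) := by
    intro k hk
    induction k with
    | zero => exact Or.inl (by simp [postPair, fwdProd, post_one])
    | succ k ih =>
      rw [fwdProd, postPair_mul (.fwdProd fun i hi => hBst i (by omega)) (hBst k hk)]
      exact ((ih (by omega)).postPair _).trans (hle k hk)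
  refine not_convergesToRankOne_pow (.fwdProd hBst) (hR 0 hp).1 ((hpost p le_rfl).trans hR0) ?_
  rw [← prod_ofFn_eq_fwdProd]
  exact h p hp hpn _ fun i => hB i i.2

lemma exists_pos_le_of_finset (s : Finset ℝ) : ∃ δ : ℝ, 0 < δ ∧ ∀ x ∈ s, 0 < x → δ ≤ x := by
  classical
  induction s using Finset.induction_on with
  | empty => exact ⟨1, one_pos, by simp⟩
  | insert a s _ ih =>
    obtain ⟨δ, hδ, h⟩ := ih
    by_cases ha : 0 < a
    · refine ⟨min δ a, lt_min hδ ha, fun x hx hx0 => ?_⟩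
      rcases Finset.mem_insert.1 hx with rfl | hx
      · exact min_le_right _ _
      · exact (min_le_left _ _).trans (h x hx hx0)
    · refine ⟨δ, hδ, fun x hx hx0 => ?_⟩
      rcases Finset.mem_insert.1 hx with rfl | hx
      · exact absurd hx0 ha
      · exact h x hx hx0

lemma le_fwdProd_apply_of_pos {n : ℕ} {A : ℕ → Matrix (Fin n) (Fin n) ℝ} {δ : ℝ} (hδ : 0 < δ)
    (hA : ∀ k, IsStochastic (A k)) (h : ∀ k i j, 0 < A k i j → δ ≤ A k i j) (k : ℕ) (i j : Fin n)
    (hpos : 0 < fwdProd A k i j) : δ ^ k ≤ fwdProd A k i j := by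
  induction k generalizing j with
  | zero =>
    rw [fwdProd, Matrix.one_apply] at hpos ⊢
    split_ifs at hpos ⊢
    · simp
    · exact absurd hpos (lt_irrefl 0)
  | succ k ih =>
    have hst : IsStochastic (fwdProd A k) := .fwdProd fun i _ => hA i
    rw [fwdProd] at hpos ⊢
    obtain ⟨l, h1, h2⟩ := (mul_apply_pos_iff hst (hA k)).1 hpos
    rw [Matrix.mul_apply, pow_succ]
    refine le_trans (mul_le_mul (ih l h1) (h k l j h2) hδ.le h1.le) ?_
    exact Finset.single_le_sum (f := fun l => fwdProd A k i l * A k l j)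
      (fun l _ => mul_nonneg (hst.1 i l) ((hA k).1 l j)) (Finset.mem_univ l)

lemma IsStochastic.sum_mul_le {n : ℕ} {Q : Matrix (Fin n) (Fin n) ℝ} (hQ : IsStochastic Q)
    {v : Fin n → ℝ} {b : ℝ} (hv : ∀ k, v k ≤ b) (i k : Fin n) :
    ∑ l, Q i l * v l ≤ b - Q i k * (b - v k) := by
  have h1 : Q i k * (b - v k) ≤ ∑ l, Q i l * (b - v l) :=
    Finset.single_le_sum (f := fun l => Q i l * (b - v l))
      (fun l _ => mul_nonneg (hQ.1 i l) (sub_nonneg.2 (hv l))) (Finset.mem_univ k)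
  have h2 : ∑ l, Q i l * (b - v l) = b - ∑ l, Q i l * v l := by
    simp only [mul_sub, Finset.sum_sub_distrib, ← Finset.sum_mul, hQ.2, one_mul]
  linarith

lemma IsStochastic.le_sum_mul {n : ℕ} {Q : Matrix (Fin n) (Fin n) ℝ} (hQ : IsStochastic Q)
    {v : Fin n → ℝ} {a : ℝ} (hv : ∀ k, a ≤ v k) (i k : Fin n) :
    a + Q i k * (v k - a) ≤ ∑ l, Q i l * v l := by
  have h := hQ.sum_mul_le (v := fun l => -v l) (b := -a) (fun l => neg_le_neg (hv l)) i k
  simp only [mul_neg, Finset.sum_neg_distrib] at h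
  linarith

/-- A scrambling stochastic matrix contracts the oscillation of a vector. -/
lemma IsStochastic.sum_mul_sub_le {n : ℕ} {Q : Matrix (Fin n) (Fin n) ℝ} (hQ : IsStochastic Q)
    {v : Fin n → ℝ} {a b ε : ℝ} (ha : ∀ k, a ≤ v k) (hb : ∀ k, v k ≤ b) {i j k : Fin n}
    (hik : ε ≤ Q i k) (hjk : ε ≤ Q j k) :
    ∑ l, Q i l * v l - ∑ l, Q j l * v l ≤ (1 - ε) * (b - a) := by
  have h1 := hQ.sum_mul_le hb i k
  have h2 := hQ.le_sum_mul ha j k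
  have h3 := mul_le_mul_of_nonneg_right hik (sub_nonneg.2 (hb k))
  have h4 := mul_le_mul_of_nonneg_right hjk (sub_nonneg.2 (ha k))
  linarith

lemma exists_tendsto_of_contraction {n : ℕ} [Nonempty (Fin n)] {v : ℕ → Fin n → ℝ} {ε : ℝ}
    (hε : 0 < ε) (N : ℕ)
    (hle : ∀ t b, (∀ k, v t k ≤ b) → ∀ k, v (t + 1) k ≤ b)
    (hge : ∀ t a, (∀ k, a ≤ v t k) → ∀ k, a ≤ v (t + 1) k)
    (hc : ∀ t a b, (∀ k, a ≤ v t k) → (∀ k, v t k ≤ b) →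
      ∀ i j, v (t + N) i - v (t + N) j ≤ (1 - ε) * (b - a)) :
    ∃ ℓ, ∀ i, Tendsto (fun t => v t i) atTop (nhds ℓ) := by
  let b : ℕ → ℝ := fun t => ⨆ i, v t i
  let a : ℕ → ℝ := fun t => ⨅ i, v t i
  have hb : ∀ t i, v t i ≤ b t := fun t i => le_ciSup (Set.finite_range (v t)).bddAbove i
  have ha : ∀ t i, a t ≤ v t i := fun t i => ciInf_le (Set.finite_range (v t)).bddBelow i
  have hbm : Antitone b := antitone_nat_of_succ_le fun t => ciSup_le (hle t _ (hb t))
  have ham : Monotone a := monotone_nat_of_le_succ fun t => le_ciInf (hge t _ (ha t))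
  obtain ⟨i₀⟩ := ‹Nonempty (Fin n)›
  have hab : ∀ t, a t ≤ b t := fun t => (ha t i₀).trans (hb t i₀)
  have hbt : Tendsto b atTop (nhds (⨅ t, b t)) := tendsto_atTop_ciInf hbm
    ⟨a 0, by rintro _ ⟨t, rfl⟩; exact (ham (Nat.zero_le t)).trans (hab t)⟩
  have hat : Tendsto a atTop (nhds (⨆ t, a t)) := tendsto_atTop_ciSup ham
    ⟨b 0, by rintro _ ⟨t, rfl⟩; exact (hab t).trans (hbm (Nat.zero_le t))⟩
  generalize (⨅ t, b t) = β at hbt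
  generalize (⨆ t, a t) = α at hat
  have hαβ : α ≤ β := le_of_tendsto_of_tendsto' hat hbt hab
  have hcon : ∀ t, b (t + N) - a (t + N) ≤ (1 - ε) * (b t - a t) := by
    intro t
    obtain ⟨i, hi⟩ := exists_eq_ciSup_of_finite (f := v (t + N))
    obtain ⟨j, hj⟩ := exists_eq_ciInf_of_finite (f := v (t + N))
    have := hc t _ _ (ha t) (hb t) i j
    rwa [hi, hj] at this
  have hlim := le_of_tendsto_of_tendsto'
    ((hbt.comp (tendsto_add_atTop_nat N)).sub (hat.comp (tendsto_add_atTop_nat N)))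
    ((hbt.sub hat).const_mul (1 - ε)) hcon
  have heq : α = β := by nlinarith
  subst heq
  exact ⟨α, fun i => tendsto_of_tendsto_of_tendsto_of_le_of_le hat hbt
    (fun t => ha t i) fun t => hb t i⟩

lemma convergesToRankOne_of_common_pos {n : ℕ} (hn : 2 ≤ n)
    {Sig : Finset (Matrix (Fin n) (Fin n) ℝ)} (hSig : ∀ A ∈ Sig, IsStochastic A) (N : ℕ)
    (h : ∀ A : ℕ → Matrix (Fin n) (Fin n) ℝ, (∀ k, A k ∈ Sig) → ∀ i j,
      ∃ k, 0 < fwdProd A N i k ∧ 0 < fwdProd A N j k)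
    {σ : ℕ → Matrix (Fin n) (Fin n) ℝ} (hσ : ∀ t, σ t ∈ Sig) :
    ConvergesToRankOne (partialProd σ) := by
  classical
  have : Nonempty (Fin n) := ⟨⟨0, by omega⟩⟩
  obtain ⟨δ, hδ, hmin⟩ := exists_pos_le_of_finset
    ((Sig ×ˢ (Finset.univ : Finset (Fin n × Fin n))).image fun z => z.1 z.2.1 z.2.2)
  have hmin' : ∀ A ∈ Sig, ∀ i j, 0 < A i j → δ ≤ A i j := fun A hA i j =>
    hmin _ (Finset.mem_image.2 ⟨(A, i, j), by simpa using hA, rfl⟩)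
  have hst : ∀ t, IsStochastic (σ t) := fun t => hSig _ (hσ t)
  have hcol : ∀ c, ∃ ℓ, ∀ i, Tendsto (fun t => partialProd σ t i c) atTop (nhds ℓ) := by
    intro c
    refine exists_tendsto_of_contraction (v := fun t i => partialProd σ t i c)
      (pow_pos hδ N) N ?_ ?_ ?_
    · intro t b hb i
      have h1 := (hst (t + 1)).sum_mul_le hb i i
      have h2 := mul_nonneg ((hst (t + 1)).1 i i) (sub_nonneg.2 (hb i))
      simp only [partialProd, Matrix.mul_apply]
      linarith
    · intro t a ha i
      have h1 := (hst (t + 1)).le_sum_mul ha i i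
      have h2 := mul_nonneg ((hst (t + 1)).1 i i) (sub_nonneg.2 (ha i))
      simp only [partialProd, Matrix.mul_apply]
      linarith
    · intro t a b ha hb i j
      have hA : ∀ k, σ (t + N - k) ∈ Sig := fun k => hσ _
      obtain ⟨k, hik, hjk⟩ := h (fun k => σ (t + N - k)) hA i j
      have hl := fun i => le_fwdProd_apply_of_pos (A := fun k => σ (t + N - k)) hδ
        (fun k => hst _) (fun k => hmin' _ (hA k)) N i k
      simp only [partialProd_add, Matrix.mul_apply]
      exact IsStochastic.sum_mul_sub_le (.fwdProd fun _ _ => hst _) ha hb (hl i hik) (hl j hjk)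
  choose ℓ hℓ using hcol
  have hL : ∀ i j, Tendsto (fun t => partialProd σ t i j) atTop
      (nhds (Matrix.vecMulVec (fun _ => 1) ℓ i j)) := by
    intro i j
    simpa [Matrix.vecMulVec_apply] using hℓ j i
  refine ⟨_, le_antisymm (Matrix.rank_vecMulVec_le _ _) ?_, hL⟩
  rw [Nat.one_le_iff_ne_zero]
  intro h0
  have hsum := sum_eq_one_of_tendsto (fun t => .partialProd hst t) hL (Classical.arbitrary _)
  rw [Matrix.rank, Submodule.finrank_eq_zero, LinearMap.range_eq_bot] at h0
  have hz := congrFun (LinearMap.congr_fun h0 fun _ => 1) (Classical.arbitrary (Fin n))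
  simp only [Matrix.mulVecLin_apply, Matrix.mulVec, dotProduct, mul_one, hsum] at hz
  exact one_ne_zero hz

lemma convergesToRankOne_pow_of_partialProd {n : ℕ} {Sig : Finset (Matrix (Fin n) (Fin n) ℝ)}
    (h : ∀ σ : ℕ → Matrix (Fin n) (Fin n) ℝ, (∀ t, σ t ∈ Sig) →
      ConvergesToRankOne (partialProd σ)) {p : ℕ} (hp : 1 ≤ p)
    {B : Fin p → Matrix (Fin n) (Fin n) ℝ} (hB : ∀ i, B i ∈ Sig) :
    ConvergesToRankOne fun t => (List.ofFn B).prod ^ t := by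
  let σ : ℕ → Matrix (Fin n) (Fin n) ℝ := fun t =>
    B (Fin.rev ⟨(t + (p - 1)) % p, Nat.mod_lt _ hp⟩)
  have hper : ∀ s, fwdProd (fun i => σ (p * s + p - i)) p = (List.ofFn B).prod := by
    intro s
    rw [← prod_ofFn_eq_fwdProd]
    congr 2
    funext i
    simp only [σ]
    congr 1
    ext
    have hi := i.2
    simp only [Fin.val_rev]
    rw [show p * s + p - i + (p - 1) = (p - 1 - i) + p * (s + 1) by
      rw [mul_add]; omega, Nat.add_mul_mod_self_left, Nat.mod_eq_of_lt (by omega)]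
    omega
  have hpow : ∀ t, partialProd σ (p * t) = (List.ofFn B).prod ^ t := by
    intro t
    induction t with
    | zero => simp [partialProd]
    | succ t ih => rw [mul_add, mul_one, partialProd_add, hper, ih, pow_succ']
  obtain ⟨L, hrank, hL⟩ := h σ fun t => hB _
  refine ⟨L, hrank, fun i j => ?_⟩
  have h2 : Tendsto (fun t : ℕ => p * t) atTop atTop := tendsto_id.const_mul_atTop' hp
  exact ((hL i j).comp h2).congr fun t => by simp only [Function.comp, hpow]

theorem stmt0 (n : ℕ) (hn : 2 ≤ n) (Sig : Finset (Matrix (Fin n) (Fin n) ℝ))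
    (hSig : ∀ A ∈ Sig, IsStochastic A) :
    (∀ σ : ℕ → Matrix (Fin n) (Fin n) ℝ, (∀ t, σ t ∈ Sig) →
      ConvergesToRankOne (partialProd σ)) ↔
    (∀ p : ℕ, 1 ≤ p → p ≤ pstar n →
      ∀ B : Fin p → Matrix (Fin n) (Fin n) ℝ, (∀ i, B i ∈ Sig) →
        ConvergesToRankOne (fun t => (List.ofFn B).prod ^ t)) :=
  ⟨fun h _ hp _ _ hB => convergesToRankOne_pow_of_partialProd h hp hB,
    fun h _ hσ => convergesToRankOne_of_common_pos hn hSig _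
      (exists_common_pos_of_short hn hSig h) hσ⟩
end

section
/- For every n ≥ 2 there exists a finite set Σ of n×n row-stochastic real matrices such that: (i) there exists a product Q of exactly p*(n) = C(n, ⌊n/3⌋)·(2^{n − ⌊n/3⌋ − 1} − 1) matrices from Σ whose powers Q^t do not converge to a rank-one matrix as t → ∞; and (ii) for every product Q of p matrices from Σ with 1 ≤ p ≤ p*(n) − 1, the powers Q^t converge, as t → ∞, to a matrix of rank one. -/
open Filter Matrix

/-- Two probability vectors sharing mass at least `δ` at some index average a vector to values
that differ by at most `1 - δ ^ 2` times its spread. -/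
theorem sum_mul_sub_sum_mul_le {ι : Type*} [Fintype ι] [DecidableEq ι] {a b v : ι → ℝ} {d δ : ℝ}
    (ha : ∀ s, 0 ≤ a s) (ha₁ : ∑ s, a s = 1) (hb : ∀ s, 0 ≤ b s) (hb₁ : ∑ s, b s = 1)
    (hv : ∀ s t, v s - v t ≤ d) (hδ : 0 ≤ δ) {u : ι} (hau : δ ≤ a u) (hbu : δ ≤ b u) :
    ∑ s, a s * v s - ∑ s, b s * v s ≤ (1 - δ ^ 2) * d := by
  have hd : 0 ≤ d := by simpa using hv u u
  have h₁ : ∑ s, a s * v s - ∑ s, b s * v s = ∑ s, ∑ t, a s * b t * (v s - v t) := by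
    have h₂ : ∑ s, ∑ t, a s * b t * v s = ∑ s, a s * v s := by
      refine Finset.sum_congr rfl fun s _ => ?_
      rw [← Finset.sum_mul, ← Finset.mul_sum, hb₁, mul_one]
    have h₃ : ∑ s, ∑ t, a s * b t * v t = ∑ t, b t * v t := by
      rw [Finset.sum_comm]
      refine Finset.sum_congr rfl fun t _ => ?_
      rw [← Finset.sum_mul, ← Finset.sum_mul, ha₁, one_mul]
    simp only [mul_sub, Finset.sum_sub_distrib, h₂, h₃]
  have h₄ : ∑ s, ∑ t, (a s * b t * d - if s = u then if t = u then δ ^ 2 * d else 0 else 0)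
      = (1 - δ ^ 2) * d := by
    simp only [Finset.sum_sub_distrib, ← Finset.sum_mul, ← Finset.mul_sum, hb₁, ha₁]
    have : ∀ s, (∑ t, if s = u then if t = u then δ ^ 2 * d else 0 else 0) =
        if s = u then δ ^ 2 * d else 0 := by
      intro s
      split_ifs <;> simp
    simp only [this]
    simp
    ring
  rw [h₁, ← h₄]
  refine Finset.sum_le_sum fun s _ => Finset.sum_le_sum fun t _ => ?_
  have hst : a s * b t * (v s - v t) ≤ a s * b t * d :=
    mul_le_mul_of_nonneg_left (hv s t) (mul_nonneg (ha s) (hb t))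
  split_ifs with h h'
  · have : δ ^ 2 * d ≤ a u * b u * d :=
      mul_le_mul_of_nonneg_right (sq δ ▸ mul_le_mul hau hbu hδ (ha u)) hd
    simpa [h, h'] using this
  · simpa using hst
  · simpa using hst

/-- A matrix is scrambling if any two rows have a common positive entry. -/
def IsScrambling {n : ℕ} (A : Matrix (Fin n) (Fin n) ℝ) : Prop :=
  ∀ r r', ∃ u, 0 < A r u ∧ 0 < A r' u

section RowStochastic

variable {n : ℕ} {A B : Matrix (Fin n) (Fin n) ℝ}

theorem exists_pos_of_mem_rowStochastic (hA : A ∈ rowStochastic ℝ (Fin n)) (r : Fin n) :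
    ∃ s, 0 < A r s := by
  by_contra! h
  have := sum_row_of_mem_rowStochastic hA r
  linarith [Finset.sum_nonpos fun s (_ : s ∈ Finset.univ) => h s]

theorem mul_apply_pos (hA : A ∈ rowStochastic ℝ (Fin n)) (hB : B ∈ rowStochastic ℝ (Fin n))
    {r s u : Fin n} (h₁ : 0 < A r s) (h₂ : 0 < B s u) : 0 < (A * B) r u := by
  rw [mul_apply]
  exact Finset.sum_pos' (fun t _ => mul_nonneg (hA.1 r t) (hB.1 t u))
    ⟨s, Finset.mem_univ s, mul_pos h₁ h₂⟩

theorem IsScrambling.mul_right (h : IsScrambling A) (hA : A ∈ rowStochastic ℝ (Fin n))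
    (hB : B ∈ rowStochastic ℝ (Fin n)) : IsScrambling (A * B) := by
  intro r r'
  obtain ⟨u, hu, hu'⟩ := h r r'
  obtain ⟨v, hv⟩ := exists_pos_of_mem_rowStochastic hB u
  exact ⟨v, mul_apply_pos hA hB hu hv, mul_apply_pos hA hB hu' hv⟩

theorem IsScrambling.mul_left (h : IsScrambling B) (hA : A ∈ rowStochastic ℝ (Fin n))
    (hB : B ∈ rowStochastic ℝ (Fin n)) : IsScrambling (A * B) := by
  intro r r'
  obtain ⟨s, hs⟩ := exists_pos_of_mem_rowStochastic hA r
  obtain ⟨s', hs'⟩ := exists_pos_of_mem_rowStochastic hA r'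
  obtain ⟨v, hv, hv'⟩ := h s s'
  exact ⟨v, mul_apply_pos hA hB hs hv, mul_apply_pos hA hB hs' hv'⟩

theorem IsScrambling.exists_le (h : IsScrambling A) :
    ∃ δ : ℝ, 0 < δ ∧ ∀ r r', ∃ u, δ ≤ A r u ∧ δ ≤ A r' u := by
  choose f hf hf' using h
  rcases isEmpty_or_nonempty (Fin n) with hn | hn
  · exact ⟨1, one_pos, fun r => isEmptyElim r⟩
  · obtain ⟨p, hp⟩ := Finite.exists_min
      fun p : Fin n × Fin n => min (A p.1 (f p.1 p.2)) (A p.2 (f p.1 p.2))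
    exact ⟨_, lt_min (hf p.1 p.2) (hf' p.1 p.2), fun r r' =>
      ⟨f r r', (hp (r, r')).trans (min_le_left _ _), (hp (r, r')).trans (min_le_right _ _)⟩⟩

theorem mul_apply_sub_mul_apply_le {A' : Matrix (Fin n) (Fin n) ℝ} {d : ℝ} {j : Fin n}
    (hA : A ∈ rowStochastic ℝ (Fin n)) (hA' : A' ∈ rowStochastic ℝ (Fin n))
    (hd : ∀ s t, B s j - B t j ≤ d) (r r' : Fin n) : (A * B) r j - (A' * B) r' j ≤ d := by
  simpa [mul_apply] using sum_mul_sub_sum_mul_le (hA.1 r) (sum_row_of_mem_rowStochastic hA r)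
    (hA'.1 r') (sum_row_of_mem_rowStochastic hA' r') hd le_rfl (hA.1 r r) (hA'.1 r' r)

theorem rank_eq_one_of_rows_eq {L : Matrix (Fin n) (Fin n) ℝ} (r₀ : Fin n)
    (hL : ∀ r j, L r j = L r₀ j) (h₀ : ∑ j, L r₀ j = 1) : L.rank = 1 := by
  have h : L = vecMulVec 1 (L r₀) := by
    ext r j
    simp [vecMulVec_apply, hL r j]
  refine le_antisymm (h ▸ rank_vecMulVec_le _ _) ?_
  rw [rank_eq_finrank_span_row, Submodule.one_le_finrank_iff]
  intro hbot
  rw [Submodule.span_eq_bot] at hbot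
  have : L r₀ = 0 := hbot _ ⟨r₀, rfl⟩
  simp [this] at h₀

theorem mul_eq_mul_of_rank_eq_one {L : Matrix (Fin n) (Fin n) ℝ} (hL : L.rank = 1)
    (r r' s s' : Fin n) : L r s * L r' s' = L r s' * L r' s := by
  rw [rank_eq_finrank_span_row] at hL
  obtain ⟨v, hv⟩ := finrank_le_one_iff.1 hL.le
  have key : ∀ r, ∃ c : ℝ, ∀ s, c * v.1 s = L r s := fun r => by
    obtain ⟨c, hc⟩ := hv ⟨L r, Submodule.subset_span ⟨r, rfl⟩⟩
    exact ⟨c, fun s => congrFun (congrArg Subtype.val hc) s⟩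
  obtain ⟨c, hc⟩ := key r
  obtain ⟨c', hc'⟩ := key r'
  rw [← hc, ← hc, ← hc', ← hc']
  ring

theorem mem_rowStochastic_of_tendsto {P : ℕ → Matrix (Fin n) (Fin n) ℝ}
    {L : Matrix (Fin n) (Fin n) ℝ} (hP : ∀ t, P t ∈ rowStochastic ℝ (Fin n))
    (hL : ∀ i j, Tendsto (fun t => P t i j) atTop (nhds (L i j))) :
    L ∈ rowStochastic ℝ (Fin n) := by
  refine mem_rowStochastic_iff_sum.2 ⟨fun i j => ge_of_tendsto' (hL i j) fun t => (hP t).1 i j,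
    fun i => ?_⟩
  refine tendsto_nhds_unique (tendsto_finsetSum _ fun j _ => hL i j) ?_
  simp only [sum_row_of_mem_rowStochastic (hP _), tendsto_const_nhds]

theorem convergesToRankOne_pow (r₀ : Fin n) (hA : A ∈ rowStochastic ℝ (Fin n))
    (h : IsScrambling (A ^ 2)) : ConvergesToRankOne fun t => A ^ t := by
  obtain ⟨δ, hδ, hδA⟩ := h.exists_le
  have hA₂ : A ^ 2 ∈ rowStochastic ℝ (Fin n) := pow_mem hA 2
  set τ := 1 - δ ^ 2
  have hτ₁ : τ < 1 := by
    have := pow_pos hδ 2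
    simp only [τ]
    linarith
  have hδ₁ : δ ≤ 1 := by
    obtain ⟨u, hu, -⟩ := hδA r₀ r₀
    exact hu.trans (le_one_of_mem_rowStochastic hA₂)
  have hτ₀ : 0 ≤ τ := by
    simp only [τ]
    nlinarith
  have spread : ∀ q j s t, ((A ^ 2) ^ q) s j - ((A ^ 2) ^ q) t j ≤ τ ^ q := by
    intro q j
    induction q with
    | zero =>
      intro s t
      simp only [pow_zero, one_apply]
      split_ifs <;> norm_num
    | succ q ih =>
      intro s t
      obtain ⟨u, hu, hu'⟩ := hδA s t
      rw [pow_succ' (A ^ 2), pow_succ' τ, mul_apply, mul_apply]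
      exact sum_mul_sub_sum_mul_le (hA₂.1 s) (sum_row_of_mem_rowStochastic hA₂ s) (hA₂.1 t)
        (sum_row_of_mem_rowStochastic hA₂ t) ih hδ.le hu hu'
  have bound : ∀ N k l, N ≤ k → N ≤ l → ∀ r r' j,
      (A ^ k) r j - (A ^ l) r' j ≤ τ ^ (N / 2) := by
    intro N k l hk hl r r' j
    have split : ∀ m, N ≤ m → A ^ m = A ^ (m - 2 * (N / 2)) * (A ^ 2) ^ (N / 2) := fun m hm => by
      rw [← pow_mul, ← pow_add]
      congr 1
      omega
    rw [split k hk, split l hl]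
    exact mul_apply_sub_mul_apply_le (pow_mem hA _) (pow_mem hA _) (spread _ j) r r'
  have lim : Tendsto (fun N => τ ^ (N / 2)) atTop (nhds 0) :=
    (tendsto_pow_atTop_nhds_zero_of_lt_one hτ₀ hτ₁).comp (Nat.tendsto_div_const_atTop two_ne_zero)
  have conv : ∀ i j, ∃ l, Tendsto (fun t => (A ^ t) i j) atTop (nhds l) := fun i j =>
    cauchySeq_tendsto_of_complete <| cauchySeq_of_le_tendsto_0 _ (fun k l N hk hl =>
      abs_sub_le_iff.2 ⟨bound N k l hk hl i i j, bound N l k hl hk i i j⟩) lim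
  choose L hL using conv
  have hLs : Matrix.of L ∈ rowStochastic ℝ (Fin n) :=
    mem_rowStochastic_of_tendsto (fun t => pow_mem hA t) hL
  have le : ∀ i i' j, L i j ≤ L i' j := fun i i' j =>
    sub_nonpos.1 <| le_of_tendsto_of_tendsto' ((hL i j).sub (hL i' j)) lim
      fun t => bound t t t le_rfl le_rfl i i' j
  exact ⟨Matrix.of L, rank_eq_one_of_rows_eq r₀ (fun r j => le_antisymm (le _ _ _) (le _ _ _))
    (sum_row_of_mem_rowStochastic hLs r₀), hL⟩

end RowStochastic

theorem isScrambling_prod_or_isChain {n : ℕ} {ι : Type*} {M : ι → Matrix (Fin n) (Fin n) ℝ}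
    (hM : ∀ i, M i ∈ rowStochastic ℝ (Fin n)) {R : ι → ι → Prop}
    (hR : ∀ i j, ¬ R i j → IsScrambling (M i * M j)) :
    ∀ l : List ι, IsScrambling (l.map M).prod ∨ l.IsChain R
  | [] => Or.inr .nil
  | [a] => Or.inr (.singleton a)
  | a :: b :: l => by
    have hprod : ∀ l : List ι, (l.map M).prod ∈ rowStochastic ℝ (Fin n) := fun l =>
      list_prod_mem (by simpa using fun i _ => hM i)
    by_cases hab : R a b
    · rcases isScrambling_prod_or_isChain hM hR (b :: l) with h | h
      · rw [List.map_cons, List.prod_cons]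
        exact Or.inl (h.mul_left (hM a) (hprod _))
      · exact Or.inr (List.isChain_cons_cons.2 ⟨hab, h⟩)
    · refine Or.inl ?_
      rw [List.map_cons, List.map_cons, List.prod_cons, List.prod_cons, ← mul_assoc]
      exact (hR a b hab).mul_right (mul_mem (hM a) (hM b)) (hprod l)

theorem eq_add_length_of_isChain {R : Type*} [AddMonoidWithOne R] {y : R} :
    ∀ {l : List R} {x : R}, (x :: (l ++ [y])).IsChain (fun i j => j = i + 1) →
      y = x + (l.length + 1 : ℕ)
  | [], x, h => by simpa using h
  | z :: l, x, h => by
    rw [List.cons_append, List.isChain_cons_cons] at h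
    rw [eq_add_length_of_isChain h.2, h.1, List.length_cons, add_assoc, ← Nat.cast_one,
      ← Nat.cast_add, add_comm 1]

/-- The set of positions of a transition matrix between two partial two-colourings: a coloured
row leads to the indices of its own colour, an uncoloured row leads everywhere. -/
def Compat {n : ℕ} (c d : Fin n → Option Bool) (r s : Fin n) : Prop :=
  c r = none ∨ c r = d s

open Classical in
/-- The stochastic matrix whose rows are uniform on the positions allowed by `Compat c d`. -/
noncomputable def transition {n : ℕ} (c d : Fin n → Option Bool) : Matrix (Fin n) (Fin n) ℝ :=
  .of fun r s => if Compat c d r s then (({u | Compat c d r u} : Finset (Fin n)).card : ℝ)⁻¹ else 0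

section Coloring

variable {n : ℕ} {c d e : Fin n → Option Bool} {A B : Matrix (Fin n) (Fin n) ℝ}

theorem exists_compat (hd : ∀ b, ∃ s, d s = some b) (r : Fin n) : ∃ s, Compat c d r s := by
  rcases h : c r with _ | b
  · exact ⟨r, Or.inl h⟩
  · obtain ⟨s, hs⟩ := hd b
    exact ⟨s, Or.inr (h.trans hs.symm)⟩

theorem transition_pos {r s : Fin n} (h : Compat c d r s) : 0 < transition c d r s := by
  classical
  simp only [transition, of_apply, if_pos h, inv_pos, Nat.cast_pos, Finset.card_pos]
  exact ⟨s, by simpa using h⟩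

theorem transition_mem_rowStochastic (hd : ∀ b, ∃ s, d s = some b) :
    transition c d ∈ rowStochastic ℝ (Fin n) := by
  classical
  refine mem_rowStochastic_iff_sum.2 ⟨fun r s => ?_, fun r => ?_⟩
  · simp only [transition, of_apply]
    split_ifs <;> positivity
  · obtain ⟨s, hs⟩ := exists_compat (c := c) hd r
    have : (({u | Compat c d r u} : Finset (Fin n)).card : ℝ) ≠ 0 :=
      Nat.cast_ne_zero.2 (Finset.card_ne_zero_of_mem (a := s) (by simpa using hs))
    simp only [transition, of_apply]
    rw [← Finset.sum_filter, Finset.sum_const, nsmul_eq_mul]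
    convert mul_inv_cancel₀ this

/-- All nonzero entries of `A` lie at positions allowed by `Compat c d`. -/
def Respects (c d : Fin n → Option Bool) (A : Matrix (Fin n) (Fin n) ℝ) : Prop :=
  ∀ r s, A r s ≠ 0 → Compat c d r s

theorem respects_transition : Respects c d (transition c d) := by
  intro r s h
  by_contra hrs
  exact h (by simp [transition, hrs])

theorem respects_one : Respects c c 1 := by
  intro r s h
  by_cases hrs : r = s
  · exact Or.inr (congrArg c hrs)
  · exact absurd (one_apply_ne hrs) h

theorem Respects.mul (hA : Respects c d A) (hB : Respects d e B) : Respects c e (A * B) := by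
  intro r u h
  rw [mul_apply] at h
  obtain ⟨s, -, hs⟩ := Finset.exists_ne_zero_of_sum_ne_zero h
  rcases hA r s (left_ne_zero_of_mul hs) with h₁ | h₁
  · exact Or.inl h₁
  · rcases hB s u (right_ne_zero_of_mul hs) with h₂ | h₂
    · exact Or.inl (h₁.trans h₂)
    · exact Or.inr (h₁.trans h₂)

theorem Respects.pow (hA : Respects c c A) (t : ℕ) : Respects c c (A ^ t) := by
  induction t with
  | zero => simpa using respects_one
  | succ t ih => exact pow_succ A t ▸ ih.mul hA

theorem not_convergesToRankOne_pow_s1 (hc : ∀ b, ∃ s, c s = some b)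
    (hA : A ∈ rowStochastic ℝ (Fin n)) (hAc : Respects c c A) :
    ¬ ConvergesToRankOne fun t => A ^ t := by
  rintro ⟨L, hL, hlim⟩
  have hLs := mem_rowStochastic_of_tendsto (fun t => pow_mem hA t) hlim
  have hLc : Respects c c L := by
    intro r s h
    by_contra hrs
    refine h (tendsto_nhds_unique (hlim r s) ?_)
    have : ∀ t, (A ^ t) r s = 0 := fun t => not_not.1 fun h => hrs (hAc.pow t r s h)
    simp only [this, tendsto_const_nhds]
  obtain ⟨a, ha⟩ := hc true
  obtain ⟨b, hb⟩ := hc false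
  obtain ⟨s, hs⟩ := exists_pos_of_mem_rowStochastic hLs a
  obtain ⟨u, hu⟩ := exists_pos_of_mem_rowStochastic hLs b
  have h : L a u * L b s ≠ 0 := mul_eq_mul_of_rank_eq_one hL a b s u ▸ (mul_pos hs hu).ne'
  have h₁ := hLc a u (left_ne_zero_of_mul h)
  have h₂ := hLc b u hu.ne'
  simp only [Compat, ha, hb, reduceCtorEq, false_or] at h₁ h₂
  simp [← h₁] at h₂

theorem isScrambling_transition_mul {c' : Fin n → Option Bool} (hd : ∀ b, ∃ s, d s = some b)
    (he : ∀ b, ∃ s, e s = some b)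
    (hcard : ({s | d s = none} : Finset (Fin n)).card = ({s | c' s = none} : Finset (Fin n)).card)
    (hne : ∀ σ : Bool → Bool, ¬ ∀ s, c' s = (d s).map σ) :
    IsScrambling (transition c d * transition c' e) := by
  have key : ∃ b s₀ s₁, d s₀ = some b ∧ d s₁ = some b ∧
      (c' s₀ = none ∨ c' s₀ = some true ∧ c' s₁ = some false) := by
    by_contra! H
    choose w hw using hd
    have hsome : ∀ s, c' s = none → d s = none := by
      intro s hs
      by_contra h
      obtain ⟨b, hb⟩ := Option.ne_none_iff_exists'.1 h
      exact (H b s s hb hb).1 hs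
    have hnone : ∀ s, d s = none → c' s = none := by
      have := Finset.eq_of_subset_of_card_le (s := {s | c' s = none}) (t := {s | d s = none})
        (fun s => by simpa using hsome s) hcard.le
      intro s hs
      have hs' : s ∈ ({s | d s = none} : Finset (Fin n)) := by simpa using hs
      rw [← this] at hs'
      simpa using hs'
    refine hne (fun b => (c' (w b)).getD true) fun s => ?_
    rcases h : d s with _ | b
    · exact hnone s h
    · have h₁ := H b s (w b) h (hw b)
      have h₂ := H b (w b) s (hw b) h
      rcases h₃ : c' s with _ | _ | _ <;> rcases h₄ : c' (w b) with _ | _ | _ <;> simp_all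
  obtain ⟨b, s₀, s₁, h₀, h₁, h⟩ := key
  have hA := transition_mem_rowStochastic (c := c) hd
  have hB := transition_mem_rowStochastic (c := c') he
  have reach : ∀ r, c r = none ∨ c r = some b → ∀ u x, e u = some x →
      0 < (transition c d * transition c' e) r u := by
    intro r hr u x hx
    have h₂ : ∀ s, d s = some b → Compat c d r s := fun s hs => by
      rwa [Compat, hs]
    by_cases h₃ : Compat c' e s₀ u
    · exact mul_apply_pos hA hB (transition_pos (h₂ s₀ h₀)) (transition_pos h₃)
    · refine mul_apply_pos hA hB (transition_pos (h₂ s₁ h₁)) (transition_pos ?_)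
      cases x <;> simp_all [Compat]
  have reach' : ∀ r r', c r = c r' → ∃ u x, e u = some x ∧
      0 < (transition c d * transition c' e) r u ∧ 0 < (transition c d * transition c' e) r' u := by
    intro r r' hrr'
    obtain ⟨s, hs⟩ := exists_compat (c := c) hd r
    obtain ⟨u, hu⟩ := he ((c' s).getD true)
    have hs' : Compat c d r' s := by
      rwa [Compat, ← hrr']
    have hsu : Compat c' e s u := by
      rcases h : c' s with _ | x <;> simp_all [Compat]
    exact ⟨u, _, hu, mul_apply_pos hA hB (transition_pos hs) (transition_pos hsu),
      mul_apply_pos hA hB (transition_pos hs') (transition_pos hsu)⟩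
  intro r r'
  by_cases hr : c r = none ∨ c r = some b
  · obtain ⟨u, x, hu, hpos, -⟩ := reach' r' r' rfl
    exact ⟨u, reach r hr u x hu, hpos⟩
  by_cases hr' : c r' = none ∨ c r' = some b
  · obtain ⟨u, x, hu, hpos, -⟩ := reach' r r rfl
    exact ⟨u, hpos, reach r' hr' u x hu⟩
  have hrr' : c r = c r' := by
    rcases h₂ : c r with _ | _ | _ <;> rcases h₃ : c r' with _ | _ | _ <;> cases b <;> simp_all
  obtain ⟨u, x, -, hpos⟩ := reach' r r' hrr'
  exact ⟨u, hpos⟩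

end Coloring

/-- There are `pstar n` partial two-colourings of `Fin n` with `n / 3` uncoloured indices, no two
of which induce the same partition of the coloured indices. -/
theorem exists_colorings (n : ℕ) (hn : 2 ≤ n) :
    0 < pstar n ∧ ∃ col : ZMod (pstar n) → Fin n → Option Bool,
      (∀ i b, ∃ s, col i s = some b) ∧
      (∀ i, ({s | col i s = none} : Finset (Fin n)).card = n / 3) ∧
      ∀ i j, i ≠ j → ∀ σ : Bool → Bool, ¬ ∀ s, col j s = (col i s).map σ := by
  have hpos : 0 < pstar n := by
    refine Nat.mul_pos (Nat.choose_pos (Nat.div_le_self n 3)) (Nat.sub_pos_of_lt ?_)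
    exact Nat.one_lt_two_pow (by omega)
  refine ⟨hpos, ?_⟩
  have : NeZero (pstar n) := ⟨hpos.ne'⟩
  obtain ⟨f, hf⟩ : ∃ f : Finset (Fin n) → Fin n, ∀ U : Finset (Fin n), U.Nonempty → f U ∈ U :=
    ⟨fun U => if h : U.Nonempty then h.choose else ⟨0, by omega⟩, fun U h => by
      simpa [h] using h.choose_spec⟩
  let F : Finset (Finset (Fin n) × Finset (Fin n)) :=
    (Finset.univ.powersetCard (n - n / 3)).biUnion fun U =>
      ((U.erase (f U)).powerset.erase ∅).map ⟨Prod.mk U, Prod.mk_right_injective U⟩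
  have memF : ∀ {U V}, (U, V) ∈ F ↔ U.card = n - n / 3 ∧ V ≠ ∅ ∧ V ⊆ U.erase (f U) := by
    simp [F]
  have hU : ∀ {U : Finset (Fin n)}, U.card = n - n / 3 → f U ∈ U := fun {U} h =>
    hf U (Finset.card_pos.1 (by omega))
  have cardF : F.card = pstar n := by
    rw [Finset.card_biUnion, Finset.sum_const_nat (m := 2 ^ (n - n / 3 - 1) - 1)]
    · rw [Finset.card_powersetCard, Finset.card_univ, Fintype.card_fin,
        Nat.choose_symm (Nat.div_le_self n 3), pstar]
    · intro U h
      rw [Finset.mem_powersetCard_univ] at h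
      rw [Finset.card_map, Finset.card_erase_of_mem (Finset.empty_mem_powerset _),
        Finset.card_powerset, Finset.card_erase_of_mem (hU h), h]
    · intro U _ U' _ hne
      refine Finset.disjoint_left.2 ?_
      rintro ⟨W, V⟩ h h'
      simp only [Finset.mem_map, Function.Embedding.coeFn_mk, Prod.mk.injEq] at h h'
      obtain ⟨_, -, rfl, -⟩ := h
      obtain ⟨_, -, rfl, -⟩ := h'
      exact hne rfl
  let E : ZMod (pstar n) ≃ F := Fintype.equivOfCardEq (by rw [ZMod.card, Fintype.card_coe, cardF])
  let c : Finset (Fin n) × Finset (Fin n) → Fin n → Option Bool := fun P s =>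
    if s ∈ P.1 then some (decide (s ∈ P.2)) else none
  have c_none : ∀ {P s}, c P s = none ↔ s ∉ P.1 := by simp [c]
  have c_true : ∀ {P : Finset (Fin n) × Finset (Fin n)} {s}, P ∈ F → s ∈ P.2 →
      c P s = some true := by
    rintro ⟨U, V⟩ s hP hs
    simp [c, Finset.mem_of_mem_erase ((memF.1 hP).2.2 hs), hs]
  have c_false : ∀ {P : Finset (Fin n) × Finset (Fin n)}, P ∈ F → c P (f P.1) = some false := by
    rintro ⟨U, V⟩ hP
    have : f U ∉ V := fun h => Finset.notMem_erase _ _ ((memF.1 hP).2.2 h)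
    simp [c, hU (memF.1 hP).1, this]
  refine ⟨fun i => c (E i).1, fun i b => ?_, fun i => ?_, fun i j hij σ hσ => hij ?_⟩
  · cases b
    · exact ⟨_, c_false (E i).2⟩
    · obtain ⟨s, hs⟩ := Finset.nonempty_iff_ne_empty.2 (memF.1 (E i).2).2.1
      exact ⟨s, c_true (E i).2 hs⟩
  · have h := (memF.1 (E i).2).1
    simp only [c_none, ← Finset.compl_filter, Finset.card_compl, Fintype.card_fin,
      Finset.filter_mem_eq_inter, Finset.univ_inter, h]
    have := Nat.div_le_self n 3
    omega
  · change ∀ s, c (E j).1 s = (c (E i).1 s).map σ at hσ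
    have hi := (E i).2
    have hj := (E j).2
    have h₁ : (E i).1.1 = (E j).1.1 := by
      ext s
      have : c (E j).1 s = none ↔ c (E i).1 s = none := by simp [hσ s]
      rw [c_none, c_none] at this
      tauto
    have h_false : σ false = false := by
      have := hσ (f (E j).1.1)
      rw [c_false hj, ← h₁, c_false hi] at this
      simpa using this.symm
    have h_true : σ true = true := by
      obtain ⟨s, hs⟩ := Finset.nonempty_iff_ne_empty.2 (memF.1 hj).2.1
      have := hσ s
      rw [c_true hj hs] at this
      rcases h : c (E i).1 s with _ | _ | _
      · simp [h] at this
      · simp [h, h_false] at this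
      · simpa [h] using this.symm
    have h₂ : (E i).1.2 = (E j).1.2 := by
      have hid : σ = id := funext fun b => by cases b <;> assumption
      have hc : c (E j).1 = c (E i).1 := funext fun s => by rw [hσ s, hid, Option.map_id, id]
      have mem2 : ∀ {P : Finset (Fin n) × Finset (Fin n)} {s}, P ∈ F →
          (s ∈ P.2 ↔ c P s = some true) := fun {P s} hP =>
        ⟨c_true hP, fun h => by
          simp only [c] at h
          split_ifs at h
          simpa using h⟩
      ext s
      rw [mem2 hi, mem2 hj, hc]
    exact E.injective (Subtype.ext (Prod.ext h₁ h₂))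

theorem stmt1 (n : ℕ) (hn : 2 ≤ n) :
    ∃ Sig : Finset (Matrix (Fin n) (Fin n) ℝ),
      (∀ A ∈ Sig, IsStochastic A) ∧
      (∃ B : Fin (pstar n) → Matrix (Fin n) (Fin n) ℝ, (∀ i, B i ∈ Sig) ∧
        ¬ ConvergesToRankOne (fun t => (List.ofFn B).prod ^ t)) ∧
      (∀ p : ℕ, 1 ≤ p → p ≤ pstar n - 1 →
        ∀ B : Fin p → Matrix (Fin n) (Fin n) ℝ, (∀ i, B i ∈ Sig) →
          ConvergesToRankOne (fun t => (List.ofFn B).prod ^ t)) := by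
  classical
  obtain ⟨hpos, col, hsurj, hcard, hne⟩ := exists_colorings n hn
  have : NeZero (pstar n) := ⟨hpos.ne'⟩
  set M : ZMod (pstar n) → Matrix (Fin n) (Fin n) ℝ := fun i => transition (col i) (col (i + 1))
  have hM : ∀ i, M i ∈ rowStochastic ℝ (Fin n) := fun i => transition_mem_rowStochastic (hsurj _)
  have hprod : ∀ l : List (ZMod (pstar n)), (l.map M).prod ∈ rowStochastic ℝ (Fin n) := fun l =>
    list_prod_mem (by simpa using fun i _ => hM i)
  refine ⟨Finset.univ.image M, ?_, ⟨fun i => M (i : ℕ), by simp, ?_⟩, ?_⟩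
  · simpa [IsStochastic, mem_rowStochastic_iff_sum] using hM
  · have hres : ∀ p : ℕ, Respects (col 0) (col p) (List.ofFn fun i : Fin p => M (i : ℕ)).prod := by
      intro p
      induction p with
      | zero => simpa using respects_one
      | succ p ih =>
        rw [List.ofFn_succ', List.concat_eq_append, List.prod_append, List.prod_singleton]
        simpa using ih.mul (respects_transition (c := col p) (d := col (p + 1)))
    refine not_convergesToRankOne_pow_s1 (hsurj 0) ?_ (by simpa using hres (pstar n))
    exact list_prod_mem (by simpa [List.mem_ofFn] using fun _ => hM _)
  · intro p hp hp' B hB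
    choose w hw using fun i => Finset.mem_image.1 (hB i)
    obtain rfl : B = M ∘ w := funext fun i => (hw i).2.symm
    rw [← List.map_ofFn]
    have hlen : (List.ofFn w).length = p := List.length_ofFn
    refine convergesToRankOne_pow ⟨0, by omega⟩ (hprod _) ?_
    rw [sq, ← List.prod_append, ← List.map_append]
    refine (isScrambling_prod_or_isChain hM (R := fun i j => j = i + 1) (fun i j hij =>
      isScrambling_transition_mul (hsurj _) (hsurj _) ((hcard _).trans (hcard _).symm)
        (hne _ _ (Ne.symm hij))) _).resolve_right fun hchain => ?_
    generalize List.ofFn w = l at hlen hchain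
    rcases l with _ | ⟨x, l⟩
    · simp at hlen
      omega
    · rw [List.append_cons, List.isChain_append] at hchain
      have h := eq_add_length_of_isChain hchain.1
      rw [left_eq_add, ZMod.natCast_eq_zero_iff] at h
      have := Nat.le_of_dvd (Nat.succ_pos _) h
      simp at hlen
      omega
end

section
/- Let n ≥ 2. In the partially ordered set D(n), the maximum cardinality of an antichain equals C(n, ⌊n/3⌋)·(2^{n − ⌊n/3⌋ − 1} − 1), and this maximum is attained by the set of all pairs of dimension d* = ⌊n/3⌋ + 1, i.e., all pairs {S,T} with |S| + |T| = n − ⌊n/3⌋. -/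
/-- An element of `D(n)`: an unordered pair of disjoint nonempty subsets of `{1,…,n}`. -/
def ValidPair {n : ℕ} (z : Sym2 (Finset (Fin n))) : Prop :=
  ∃ S T : Finset (Fin n), z = s(S, T) ∧ Disjoint S T ∧ S.Nonempty ∧ T.Nonempty

/-- The order on `D(n)`: `{S,T} ⪯ {S',T'}` iff (S' ⊆ S and T' ⊆ T) or (S' ⊆ T and T' ⊆ S).
Both disjuncts are covered by quantifying over the representatives of the `Sym2` elements. -/
def PairLe {n : ℕ} (z z' : Sym2 (Finset (Fin n))) : Prop :=
  ∃ S T S' T' : Finset (Fin n), z = s(S, T) ∧ z' = s(S', T') ∧ S' ⊆ S ∧ T' ⊆ T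

open Finset in
/-- If every element of `L` has at least `d` `r`-predecessors in `M`, and every element of `M` has at
most `d` `r`-successors in `L`, then the part of an antichain in `L` may be replaced by its set of
predecessors in `M` without losing cardinality. -/
theorem IsAntichain.exists_replace_level {α : Type*} [DecidableEq α] (r : α → α → Prop)
    [DecidableRel r] [IsTrans α r] {A L M : Finset α} {d : ℕ} (hd : 0 < d)
    (hA : IsAntichain r (A : Set α)) (hM : IsAntichain r (M : Set α))
    (hL : ∀ y ∈ L, d ≤ #{x ∈ M | r x y}) (hM' : ∀ x ∈ M, #{y ∈ L | r x y} ≤ d)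
    (hAM : ∀ a ∈ A, a ∉ L → ∀ x ∈ M, ¬ r x a) :
    ∃ A' : Finset α, IsAntichain r (A' : Set α) ∧ #A ≤ #A' ∧ A' ⊆ A \ L ∪ M := by
  classical
  set N : Finset α := {x ∈ M | ∃ y ∈ A ∩ L, r x y} with hN
  have hcard : #(A ∩ L) ≤ #N := by
    refine Nat.le_of_mul_le_mul_right
      (card_mul_le_card_mul (fun y x => r x y) (m := d) (n := d) ?_ ?_) hd
    · intro y hy
      refine (hL y (mem_inter.1 hy).2).trans (card_le_card fun x hx => ?_)
      simp only [mem_filter, bipartiteAbove, hN] at hx ⊢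
      exact ⟨⟨hx.1, y, hy, hx.2⟩, hx.2⟩
    · intro x hx
      refine le_trans (card_le_card fun y hy => ?_) (hM' x (mem_filter.1 hx).1)
      simp only [mem_filter, bipartiteBelow, mem_inter] at hy ⊢
      exact ⟨hy.1.2, hy.2⟩
  have hdisj : Disjoint (A \ L) N := by
    rw [disjoint_left]
    intro a ha haN
    obtain ⟨-, y, hy, hay⟩ := mem_filter.1 haN
    obtain ⟨haA, haL⟩ := mem_sdiff.1 ha
    obtain ⟨hyA, hyL⟩ := mem_inter.1 hy
    exact hA haA hyA (fun h => haL (h ▸ hyL)) hay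
  refine ⟨A \ L ∪ N, ?_, ?_, union_subset_union_right (filter_subset _ _)⟩
  · intro a ha b hb hab hr
    rw [mem_coe, mem_union] at ha hb
    rcases ha with ha | ha <;> rcases hb with hb | hb
    · exact hA (mem_sdiff.1 ha).1 (mem_sdiff.1 hb).1 hab hr
    · obtain ⟨-, y, hy, hby⟩ := mem_filter.1 hb
      obtain ⟨haA, haL⟩ := mem_sdiff.1 ha
      obtain ⟨hyA, hyL⟩ := mem_inter.1 hy
      exact hA haA hyA (fun h => haL (h ▸ hyL)) (_root_.trans hr hby)
    · exact hAM b (mem_sdiff.1 hb).1 (mem_sdiff.1 hb).2 a (mem_filter.1 ha).1 hr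
    · exact hM (mem_filter.1 ha).1 (mem_filter.1 hb).1 hab hr
  · rw [card_union_of_disjoint hdisj, ← card_sdiff_add_card_inter A L]
    omega

namespace DisjointPair

open Finset

variable {n : ℕ}

instance : DecidableLT (Finset (Fin n) × Finset (Fin n)) :=
  fun _ _ => decidable_of_iff _ Prod.lt_iff.symm

/-- The ordered pairs of disjoint nonempty subsets of `Fin n` whose union has `k` elements. -/
def level (n k : ℕ) : Finset (Finset (Fin n) × Finset (Fin n)) :=
  {p | Disjoint p.1 p.2 ∧ p.1.Nonempty ∧ p.2.Nonempty ∧ #p.1 + #p.2 = k}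

theorem mem_level {k : ℕ} {p : Finset (Fin n) × Finset (Fin n)} :
    p ∈ level n k ↔ Disjoint p.1 p.2 ∧ p.1.Nonempty ∧ p.2.Nonempty ∧ #p.1 + #p.2 = k := by
  simp [level]

theorem card_add_card_lt_of_lt {p q : Finset (Fin n) × Finset (Fin n)} (h : p < q) :
    #p.1 + #p.2 < #q.1 + #q.2 := by
  rcases Prod.lt_iff.1 h with ⟨h1, h2⟩ | ⟨h1, h2⟩
  · exact Nat.add_lt_add_of_lt_of_le (card_lt_card h1) (card_le_card h2)
  · exact Nat.add_lt_add_of_le_of_lt (card_le_card h1) (card_lt_card h2)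

theorem isAntichain_level (n k : ℕ) :
    IsAntichain (· < ·) (level n k : Set (Finset (Fin n) × Finset (Fin n))) := by
  intro p hp q hq _ h
  have := card_add_card_lt_of_lt h
  have := (mem_level.1 hp).2.2.2
  have := (mem_level.1 hq).2.2.2
  omega

theorem exists_insert_of_lt {p q : Finset (Fin n) × Finset (Fin n)} (h : p < q)
    (hc : #q.1 + #q.2 = #p.1 + #p.2 + 1) :
    (∃ a ∉ p.1, q = (insert a p.1, p.2)) ∨ ∃ a ∉ p.2, q = (p.1, insert a p.2) := by
  obtain ⟨h1, h2⟩ := Prod.le_def.1 h.le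
  have c1 := card_le_card h1
  have c2 := card_le_card h2
  rcases (by omega : #q.1 = #p.1 + 1 ∧ #q.2 = #p.2 ∨ #q.1 = #p.1 ∧ #q.2 = #p.2 + 1) with
    ⟨e1, e2⟩ | ⟨e1, e2⟩
  · obtain ⟨a, ha, hq⟩ := exists_eq_insert_iff.2 ⟨h1, e1.symm⟩
    exact .inl ⟨a, ha, Prod.ext hq.symm (eq_of_subset_of_card_le h2 e2.le).symm⟩
  · obtain ⟨a, ha, hq⟩ := exists_eq_insert_iff.2 ⟨h2, e2.symm⟩
    exact .inr ⟨a, ha, Prod.ext (eq_of_subset_of_card_le h1 e1.le).symm hq.symm⟩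

theorem card_compl_union {k : ℕ} {p : Finset (Fin n) × Finset (Fin n)} (hp : p ∈ level n k) :
    #(p.1 ∪ p.2)ᶜ = n - k := by
  obtain ⟨hd, -, -, hk⟩ := mem_level.1 hp
  rw [card_compl, card_union_of_disjoint hd, hk, Fintype.card_fin]

theorem card_upper_le {k : ℕ} {p : Finset (Fin n) × Finset (Fin n)} (hp : p ∈ level n k) :
    #{q ∈ level n (k + 1) | p < q} ≤ 2 * (n - k) := by
  obtain ⟨-, -, -, hk⟩ := mem_level.1 hp
  calc _ ≤ #((p.1 ∪ p.2)ᶜ.image (fun a => (insert a p.1, p.2)) ∪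
        (p.1 ∪ p.2)ᶜ.image (fun a => (p.1, insert a p.2))) := by
        refine card_le_card fun q hq => ?_
        obtain ⟨hq, hpq⟩ := mem_filter.1 hq
        obtain ⟨hd, -, -, hk'⟩ := mem_level.1 hq
        rw [mem_union, mem_image, mem_image]
        rcases exists_insert_of_lt hpq (by omega) with ⟨a, ha, rfl⟩ | ⟨a, ha, rfl⟩
        · refine .inl ⟨a, ?_, rfl⟩
          have := disjoint_left.1 hd (mem_insert_self a _)
          simp_all
        · refine .inr ⟨a, ?_, rfl⟩
          have := disjoint_right.1 hd (mem_insert_self a _)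
          simp_all
    _ ≤ #(p.1 ∪ p.2)ᶜ + #(p.1 ∪ p.2)ᶜ :=
        (card_union_le _ _).trans (add_le_add card_image_le card_image_le)
    _ = 2 * (n - k) := by rw [card_compl_union hp, two_mul]

theorem le_card_upper {k : ℕ} {p : Finset (Fin n) × Finset (Fin n)} (hp : p ∈ level n k) :
    2 * (n - k) ≤ #{q ∈ level n (k + 1) | p < q} := by
  have hc := card_compl_union hp
  obtain ⟨hd, h1, h2, hk⟩ := mem_level.1 hp
  have i1 : Set.InjOn (fun a => (insert a p.1, p.2)) ((p.1 ∪ p.2)ᶜ : Finset (Fin n)) := by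
    intro a ha b hb hab
    simp only [coe_compl, coe_union, Set.mem_compl_iff, Set.mem_union, mem_coe, not_or] at ha hb
    exact insert_inj ha.1 |>.1 (Prod.ext_iff.1 hab).1
  have i2 : Set.InjOn (fun a => (p.1, insert a p.2)) ((p.1 ∪ p.2)ᶜ : Finset (Fin n)) := by
    intro a ha b hb hab
    simp only [coe_compl, coe_union, Set.mem_compl_iff, Set.mem_union, mem_coe, not_or] at ha hb
    exact insert_inj ha.2 |>.1 (Prod.ext_iff.1 hab).2
  have hdisj : Disjoint ((p.1 ∪ p.2)ᶜ.image (fun a => (insert a p.1, p.2)))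
      ((p.1 ∪ p.2)ᶜ.image (fun a => (p.1, insert a p.2))) := by
    rw [disjoint_left]
    intro q hq hq'
    obtain ⟨a, ha, rfl⟩ := mem_image.1 hq
    obtain ⟨b, -, hb⟩ := mem_image.1 hq'
    simp only [mem_compl, mem_union, not_or] at ha
    exact ha.1 ((Prod.ext_iff.1 hb).1 ▸ mem_insert_self a _)
  have c1 := card_image_of_injOn i1
  have c2 := card_image_of_injOn i2
  rw [two_mul, ← hc]
  nth_rewrite 1 [← c1]
  rw [← c2, ← card_union_of_disjoint hdisj]
  refine card_le_card fun q hq => ?_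
  rw [mem_filter, mem_level]
  rcases mem_union.1 hq with hq | hq
  · obtain ⟨a, ha, rfl⟩ := mem_image.1 hq
    simp only [mem_compl, mem_union, not_or] at ha
    refine ⟨⟨?_, insert_nonempty _ _, h2, ?_⟩, Prod.lt_iff.2 (.inl ⟨ssubset_insert ha.1, le_rfl⟩)⟩
    · simpa [disjoint_insert_left] using ⟨ha.2, hd⟩
    · simp only [card_insert_of_notMem ha.1]; omega
  · obtain ⟨a, ha, rfl⟩ := mem_image.1 hq
    simp only [mem_compl, mem_union, not_or] at ha
    refine ⟨⟨?_, h1, insert_nonempty _ _, ?_⟩, Prod.lt_iff.2 (.inr ⟨le_rfl, ssubset_insert ha.2⟩)⟩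
    · simpa [disjoint_insert_right] using ⟨ha.1, hd⟩
    · simp only [card_insert_of_notMem ha.2]; omega

theorem card_lower_le {k : ℕ} {q : Finset (Fin n) × Finset (Fin n)} (hq : q ∈ level n (k + 1)) :
    #{p ∈ level n k | p < q} ≤ k + 1 := by
  obtain ⟨-, -, -, hk⟩ := mem_level.1 hq
  calc _ ≤ #(q.1.image (fun a => (q.1.erase a, q.2)) ∪
        q.2.image (fun a => (q.1, q.2.erase a))) := by
        refine card_le_card fun p hp => ?_
        obtain ⟨hp, hpq⟩ := mem_filter.1 hp
        obtain ⟨-, -, -, hk'⟩ := mem_level.1 hp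
        rw [mem_union, mem_image, mem_image]
        rcases exists_insert_of_lt hpq (by omega) with ⟨a, ha, rfl⟩ | ⟨a, ha, rfl⟩
        · exact .inl ⟨a, mem_insert_self _ _, by simp [erase_insert ha]⟩
        · exact .inr ⟨a, mem_insert_self _ _, by simp [erase_insert ha]⟩
    _ ≤ #q.1 + #q.2 := (card_union_le _ _).trans (add_le_add card_image_le card_image_le)
    _ = k + 1 := hk

theorem image_erase_fst_subset {k : ℕ} {q : Finset (Fin n) × Finset (Fin n)}
    (hq : q ∈ level n (k + 1)) (h : 1 < #q.1) :
    q.1.image (fun a => (q.1.erase a, q.2)) ⊆ {p ∈ level n k | p < q} := by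
  obtain ⟨hd, -, h2, hk⟩ := mem_level.1 hq
  intro p hp
  obtain ⟨a, ha, rfl⟩ := mem_image.1 hp
  have hc := card_erase_of_mem ha
  refine mem_filter.2 ⟨mem_level.2 ⟨hd.mono_left (erase_subset _ _), ?_, h2, ?_⟩,
    Prod.lt_iff.2 (.inl ⟨erase_ssubset ha, le_rfl⟩)⟩
  · exact card_pos.1 (by simp only; omega)
  · simp only; omega

theorem image_erase_snd_subset {k : ℕ} {q : Finset (Fin n) × Finset (Fin n)}
    (hq : q ∈ level n (k + 1)) (h : 1 < #q.2) :
    q.2.image (fun a => (q.1, q.2.erase a)) ⊆ {p ∈ level n k | p < q} := by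
  obtain ⟨hd, h1, -, hk⟩ := mem_level.1 hq
  intro p hp
  obtain ⟨a, ha, rfl⟩ := mem_image.1 hp
  have hc := card_erase_of_mem ha
  refine mem_filter.2 ⟨mem_level.2 ⟨hd.mono_right (erase_subset _ _), h1, ?_, ?_⟩,
    Prod.lt_iff.2 (.inr ⟨le_rfl, erase_ssubset ha⟩)⟩
  · exact card_pos.1 (by simp only; omega)
  · simp only; omega

theorem le_card_lower {k : ℕ} (hk2 : 2 ≤ k) {q : Finset (Fin n) × Finset (Fin n)}
    (hq : q ∈ level n (k + 1)) : k ≤ #{p ∈ level n k | p < q} := by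
  obtain ⟨-, h1, h2, hk⟩ := mem_level.1 hq
  have h1 := h1.card_pos
  have h2 := h2.card_pos
  have c1 : #(q.1.image (fun a => (q.1.erase a, q.2))) = #q.1 :=
    card_image_of_injOn fun a ha b _ hab => (erase_inj _ ha).1 (Prod.ext_iff.1 hab).1
  have c2 : #(q.2.image (fun a => (q.1, q.2.erase a))) = #q.2 :=
    card_image_of_injOn fun a ha b _ hab => (erase_inj _ ha).1 (Prod.ext_iff.1 hab).2
  by_cases e1 : #q.1 = 1
  · have := card_le_card (image_erase_snd_subset hq (by omega))
    omega
  by_cases e2 : #q.2 = 1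
  · have := card_le_card (image_erase_fst_subset hq (by omega))
    omega
  have hdisj : Disjoint (q.1.image (fun a => (q.1.erase a, q.2)))
      (q.2.image (fun a => (q.1, q.2.erase a))) := by
    rw [disjoint_left]
    intro p hp hp'
    obtain ⟨a, ha, rfl⟩ := mem_image.1 hp
    obtain ⟨b, -, hb⟩ := mem_image.1 hp'
    have hqa : q.1 = q.1.erase a := (Prod.ext_iff.1 hb).1
    exact notMem_erase a q.1 (hqa ▸ ha)
  have := card_le_card (union_subset (image_erase_fst_subset hq (by omega))
    (image_erase_snd_subset hq (by omega)))
  rw [card_union_of_disjoint hdisj] at this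
  omega

/-- An antichain in levels `m, …, m + j` is no larger than level `m`, for `m ≥ 2 n / 3`. -/
theorem card_le_card_level {m : ℕ} (hm2 : 2 ≤ m) (hm : 2 * n ≤ 3 * m) (j : ℕ)
    {A : Finset (Finset (Fin n) × Finset (Fin n))}
    (hA : IsAntichain (· < ·) (A : Set (Finset (Fin n) × Finset (Fin n))))
    (hAm : ∀ p ∈ A, ∃ k, m ≤ k ∧ k ≤ m + j ∧ p ∈ level n k) : #A ≤ #(level n m) := by
  induction j generalizing A with
  | zero =>
    refine card_le_card fun p hp => ?_
    obtain ⟨k, h1, h2, h3⟩ := hAm p hp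
    rwa [show m = k by omega]
  | succ j ih =>
    obtain ⟨A', hA', hc, hsub⟩ := hA.exists_replace_level (· < ·) (L := level n (m + j + 1))
      (M := level n (m + j)) (d := m + j) (by omega) (isAntichain_level _ _)
      (fun q hq => le_card_lower (by omega) hq)
      (fun p hp => (card_upper_le hp).trans (by omega)) (by
        intro a ha haL p hp hpa
        obtain ⟨k, h1, h2, h3⟩ := hAm a ha
        have := card_add_card_lt_of_lt hpa
        have := (mem_level.1 hp).2.2.2
        have := (mem_level.1 h3).2.2.2
        exact haL (by rwa [show m + j + 1 = k by omega]))
    refine hc.trans (ih hA' fun p hp => ?_)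
    rcases mem_union.1 (hsub hp) with h | h
    · obtain ⟨hpA, hpL⟩ := mem_sdiff.1 h
      obtain ⟨k, h1, h2, h3⟩ := hAm p hpA
      have : k ≠ m + j + 1 := by rintro rfl; exact hpL h3
      exact ⟨k, h1, by omega, h3⟩
    · exact ⟨_, by omega, le_rfl, h⟩

/-- An antichain in levels `≥ m - j` can be moved to levels `≥ m`, for `m ≤ (2 n + 2) / 3`. -/
theorem exists_antichain_ge {m : ℕ} (hmn : m ≤ n) (hm : 3 * m ≤ 2 * n + 2) (j : ℕ)
    {A : Finset (Finset (Fin n) × Finset (Fin n))}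
    (hA : IsAntichain (· < ·) (A : Set (Finset (Fin n) × Finset (Fin n))))
    (hAm : ∀ p ∈ A, ∃ k, m ≤ k + j ∧ p ∈ level n k) :
    ∃ A' : Finset (Finset (Fin n) × Finset (Fin n)),
      IsAntichain (· < ·) (A' : Set (Finset (Fin n) × Finset (Fin n))) ∧
      #A ≤ #A' ∧ ∀ p ∈ A', ∃ k, m ≤ k ∧ p ∈ level n k := by
  induction j generalizing A with
  | zero => exact ⟨A, hA, le_rfl, hAm⟩
  | succ j ih =>
    by_cases hj : m ≤ j
    · exact ih hA fun p hp => let ⟨k, _, h2⟩ := hAm p hp; ⟨k, by omega, h2⟩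
    obtain ⟨i, rfl⟩ : ∃ i, m = i + j + 1 := ⟨m - j - 1, by omega⟩
    obtain ⟨A', hA', hc, hsub⟩ := IsAntichain.exists_replace_level (· > ·) (A := A)
      (L := level n i) (M := level n (i + 1)) (d := 2 * (n - i)) (by omega)
      hA.flip (isAntichain_level _ _).flip
      (fun q hq => le_card_upper hq)
      (fun p hp => (card_lower_le hp).trans (by omega)) (by
        intro a ha haL p hp hpa
        obtain ⟨k, h1, h3⟩ := hAm a ha
        have := card_add_card_lt_of_lt hpa
        have := (mem_level.1 hp).2.2.2
        have := (mem_level.1 h3).2.2.2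
        exact haL (by rwa [show i = k by omega]))
    obtain ⟨A'', h1, h2, h3⟩ := ih (A := A') hA'.flip fun p hp => by
      rcases mem_union.1 (hsub hp) with h | h
      · obtain ⟨hpA, hpL⟩ := mem_sdiff.1 h
        obtain ⟨k, h1, h3⟩ := hAm p hpA
        have : k ≠ i := by rintro rfl; exact hpL h3
        exact ⟨k, by omega, h3⟩
      · exact ⟨_, by omega, h⟩
    exact ⟨A'', h1, hc.trans h2, h3⟩

theorem card_level (n : ℕ) {m : ℕ} (hm : 1 ≤ m) :
    #(level n m) = n.choose m * (2 ^ m - 2) := by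
  have hmaps : ∀ p ∈ level n m, p.1 ∪ p.2 ∈ powersetCard m (univ : Finset (Fin n)) := by
    intro p hp
    obtain ⟨hd, -, -, hk⟩ := mem_level.1 hp
    simp [mem_powersetCard, card_union_of_disjoint hd, hk]
  rw [card_eq_sum_card_fiberwise hmaps, sum_const_nat (m := 2 ^ m - 2), card_powersetCard,
    card_univ, Fintype.card_fin]
  intro U hU
  have hUm := (mem_powersetCard.1 hU).2
  have hU0 : U.Nonempty := card_pos.1 (by omega)
  have : {p ∈ level n m | p.1 ∪ p.2 = U} =
      ((U.powerset.erase ∅).erase U).image (fun S => (S, U \ S)) := by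
    ext ⟨S, T⟩
    simp only [mem_filter, mem_level, mem_image, mem_erase, mem_powerset, Prod.mk.injEq]
    constructor
    · rintro ⟨⟨hd, h1, h2, -⟩, rfl⟩
      refine ⟨S, ⟨?_, h1.ne_empty, subset_union_left⟩, rfl, ?_⟩
      · intro h
        have : T ⊆ S := h ▸ subset_union_right
        exact h2.ne_empty (disjoint_self.1 (hd.mono_left this))
      · rw [union_sdiff_cancel_left hd]
    · rintro ⟨S, ⟨h1, h2, h3⟩, rfl, rfl⟩
      refine ⟨⟨disjoint_sdiff, nonempty_iff_ne_empty.2 h2, sdiff_nonempty.2 fun h => ?_, ?_⟩,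
        union_sdiff_of_subset h3⟩
      · exact h1 (h3.antisymm h)
      · rw [add_comm, card_sdiff_add_card_eq_card h3, hUm]
  rw [this, card_image_of_injective _ (fun S T h => (Prod.ext_iff.1 h).1), card_erase_of_mem,
    card_erase_of_mem, card_powerset, hUm]
  · omega
  · simp
  · simp [hU0.ne_empty]

open Classical in
/-- The ordered pairs representing the elements of a set of unordered pairs. -/
noncomputable def orderedPairs (𝒜 : Set (Sym2 (Finset (Fin n)))) :
    Finset (Finset (Fin n) × Finset (Fin n)) :=
  {p | s(p.1, p.2) ∈ 𝒜}

theorem mem_orderedPairs {𝒜 : Set (Sym2 (Finset (Fin n)))}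
    {p : Finset (Fin n) × Finset (Fin n)} : p ∈ orderedPairs 𝒜 ↔ s(p.1, p.2) ∈ 𝒜 := by
  simp [orderedPairs]

theorem validPair_mk {S T : Finset (Fin n)} :
    ValidPair s(S, T) ↔ Disjoint S T ∧ S.Nonempty ∧ T.Nonempty := by
  constructor
  · rintro ⟨S', T', h, hd, h1, h2⟩
    rcases Sym2.eq_iff.1 h with ⟨rfl, rfl⟩ | ⟨rfl, rfl⟩
    · exact ⟨hd, h1, h2⟩
    · exact ⟨hd.symm, h2, h1⟩
  · rintro ⟨hd, h1, h2⟩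
    exact ⟨S, T, rfl, hd, h1, h2⟩

theorem card_orderedPairs {𝒜 : Set (Sym2 (Finset (Fin n)))} (h : ∀ z ∈ 𝒜, ValidPair z) :
    #(orderedPairs 𝒜) = 2 * 𝒜.ncard := by
  classical
  rw [Set.ncard_eq_toFinset_card' 𝒜, card_eq_sum_card_fiberwise
    (f := fun p : Finset (Fin n) × Finset (Fin n) => s(p.1, p.2)) (t := 𝒜.toFinset)
    (fun p hp => by simpa using mem_orderedPairs.1 hp), sum_const_nat (m := 2), mul_comm]
  intro z hz
  rw [Set.mem_toFinset] at hz
  obtain ⟨S, T, rfl, hd, h1, h2⟩ := h z hz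
  have hne : S ≠ T := by
    rintro rfl
    exact h1.ne_empty (disjoint_self.1 hd)
  have : {p ∈ orderedPairs 𝒜 | s(p.1, p.2) = s(S, T)} = {(S, T), (T, S)} := by
    ext ⟨S', T'⟩
    simp only [mem_filter, mem_orderedPairs, Sym2.eq_iff, mem_insert, mem_singleton,
      Prod.mk.injEq, and_iff_right_iff_imp]
    rintro (⟨rfl, rfl⟩ | ⟨rfl, rfl⟩)
    · exact hz
    · rwa [Sym2.eq_swap]
  rw [this, card_pair (by simp [hne])]

theorem isAntichain_orderedPairs {𝒜 : Set (Sym2 (Finset (Fin n)))}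
    (hA : IsAntichain PairLe 𝒜) :
    IsAntichain (· < ·) (orderedPairs 𝒜 : Set (Finset (Fin n) × Finset (Fin n))) := by
  rintro ⟨S, T⟩ hp ⟨S', T'⟩ hq _ hlt
  have hp := mem_orderedPairs.1 hp
  have hq := mem_orderedPairs.1 hq
  obtain ⟨h1, h2⟩ := Prod.le_def.1 hlt.le
  refine hA hq hp ?_ ⟨S', T', S, T, rfl, rfl, h1, h2⟩
  intro heq
  have := card_add_card_lt_of_lt hlt
  rcases Sym2.eq_iff.1 heq with ⟨rfl, rfl⟩ | ⟨rfl, rfl⟩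
  · exact lt_irrefl _ this
  · simp only at this
    omega

theorem orderedPairs_setOf (k : ℕ) :
    orderedPairs {z : Sym2 (Finset (Fin n)) | ValidPair z ∧
      ∃ S T : Finset (Fin n), z = s(S, T) ∧ #S + #T = k} = level n k := by
  ext ⟨S, T⟩
  simp only [mem_orderedPairs, mem_level, Set.mem_ofPred_eq, validPair_mk, and_assoc]
  refine and_congr_right fun _ => and_congr_right fun _ => and_congr_right fun _ => ⟨?_, ?_⟩
  · rintro ⟨S', T', h, hk⟩
    rcases Sym2.eq_iff.1 h with ⟨rfl, rfl⟩ | ⟨rfl, rfl⟩ <;> omega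
  · exact fun hk => ⟨S, T, rfl, hk⟩

theorem isAntichain_setOf (k : ℕ) :
    IsAntichain PairLe {z : Sym2 (Finset (Fin n)) | ValidPair z ∧
      ∃ S T : Finset (Fin n), z = s(S, T) ∧ #S + #T = k} := by
  rintro _ hz _ hz' hne ⟨S, T, S', T', rfl, rfl, h1, h2⟩
  rw [← mem_orderedPairs (p := (S, T)), orderedPairs_setOf, mem_level] at hz
  rw [← mem_orderedPairs (p := (S', T')), orderedPairs_setOf, mem_level] at hz'
  have e := hz.2.2.2
  have e' := hz'.2.2.2
  simp only at e e'
  have c1 := card_le_card h1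
  have c2 := card_le_card h2
  rw [eq_of_subset_of_card_le h1 (by omega), eq_of_subset_of_card_le h2 (by omega)] at hne
  exact hne rfl

end DisjointPair

theorem stmt7 (n : ℕ) (hn : 2 ≤ n) :
    (IsAntichain PairLe
        {z : Sym2 (Finset (Fin n)) | ValidPair z ∧
          ∃ S T : Finset (Fin n), z = s(S, T) ∧ S.card + T.card = n - n / 3} ∧
      Set.ncard
        {z : Sym2 (Finset (Fin n)) | ValidPair z ∧
          ∃ S T : Finset (Fin n), z = s(S, T) ∧ S.card + T.card = n - n / 3}
        = n.choose (n / 3) * (2 ^ (n - n / 3 - 1) - 1)) ∧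
    ∀ 𝒜 : Set (Sym2 (Finset (Fin n))), (∀ z ∈ 𝒜, ValidPair z) →
      IsAntichain PairLe 𝒜 →
      𝒜.ncard ≤ n.choose (n / 3) * (2 ^ (n - n / 3 - 1) - 1) := by
  have hlevel : (DisjointPair.level n (n - n / 3)).card =
      2 * (n.choose (n / 3) * (2 ^ (n - n / 3 - 1) - 1)) := by
    rw [DisjointPair.card_level n (by omega), Nat.choose_symm (Nat.div_le_self n 3),
      mul_left_comm 2]
    obtain ⟨k, hk⟩ : ∃ k, n - n / 3 = k + 1 := ⟨n - n / 3 - 1, by omega⟩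
    rw [hk, Nat.add_sub_cancel, pow_succ',
      show 2 * 2 ^ k - 2 = 2 * (2 ^ k - 1) by omega]
  refine ⟨⟨DisjointPair.isAntichain_setOf _, ?_⟩, fun 𝒜 hv hA => ?_⟩
  · refine Nat.eq_of_mul_eq_mul_left two_pos ?_
    rw [← DisjointPair.card_orderedPairs fun z hz => hz.1, DisjointPair.orderedPairs_setOf, hlevel]
  · refine Nat.le_of_mul_le_mul_left ?_ two_pos
    rw [← DisjointPair.card_orderedPairs hv, ← hlevel]
    obtain ⟨A', hA', hc, hA'm⟩ := DisjointPair.exists_antichain_ge (m := n - n / 3)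
      (by omega) (by omega) (n - n / 3) (DisjointPair.isAntichain_orderedPairs hA)
      (fun p hp => by
        obtain ⟨hd, h1, h2⟩ := DisjointPair.validPair_mk.1
          (hv _ (DisjointPair.mem_orderedPairs.1 hp))
        exact ⟨_, by omega, DisjointPair.mem_level.2 ⟨hd, h1, h2, rfl⟩⟩)
    refine hc.trans (DisjointPair.card_le_card_level (by omega) (by omega) n hA' fun p hp => ?_)
    obtain ⟨k, hk, hpk⟩ := hA'm p hp
    refine ⟨k, hk, ?_, hpk⟩
    obtain ⟨hd, -, -, hkp⟩ := DisjointPair.mem_level.1 hpk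
    have := Finset.card_le_univ (p.1 ∪ p.2)
    rw [Finset.card_union_of_disjoint hd, Fintype.card_fin] at this
    omega
end

section
/- Let n ≥ 3 and let d satisfy 1 ≤ d and 3d ≤ n. Let 𝒮 be any family of unordered pairs {S,T} of disjoint nonempty subsets of {1,…,n} with |S| + |T| = n − d + 1. Let ∇𝒮 be the set of unordered pairs {S',T'} of disjoint nonempty subsets with |S'| + |T'| = n − d that are obtained from some member {S,T} of 𝒮 by deleting a single element from S or from T (keeping both parts nonempty). Then |∇𝒮| ≥ |𝒮|. -/
/-- The pair `z'` arises from the pair `z` by deleting one element from a part of `z` with at least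
two elements. -/
def IsDeletion {α : Type*} [DecidableEq α] (z z' : Sym2 (Finset α)) : Prop :=
  ∃ S T : Finset α, ∃ a ∈ S, z = s(S, T) ∧ (S.erase a).Nonempty ∧ z' = s(S.erase a, T)

theorem isDeletion_erase {α : Type*} [DecidableEq α] {S T : Finset α} (h : Disjoint S T) {a : α}
    (ha : a ∈ S ∪ T) (hS : (S.erase a).Nonempty) (hT : (T.erase a).Nonempty) :
    IsDeletion s(S, T) s(S.erase a, T.erase a) := by
  rcases Finset.mem_union.1 ha with ha | ha
  · refine ⟨S, T, a, ha, rfl, hS, ?_⟩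
    rw [Finset.erase_eq_of_notMem (Finset.disjoint_left.1 h ha)]
  · refine ⟨T, S, a, ha, Sym2.eq_swap, hT, ?_⟩
    rw [Finset.erase_eq_of_notMem (Finset.disjoint_right.1 h ha), Sym2.eq_swap]

theorem injOn_erase_pair {α : Type*} [DecidableEq α] (S T : Finset α) :
    Set.InjOn (fun a => s(S.erase a, T.erase a)) (S ∪ T : Finset α) := by
  intro a ha b _ hab
  have key : (S ∪ T).erase a = (S ∪ T).erase b := by
    simp only [Finset.erase_union_distrib]
    rcases Sym2.eq_iff.1 hab with ⟨h₁, h₂⟩ | ⟨h₁, h₂⟩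
    · rw [h₁, h₂]
    · rw [h₁, h₂, Finset.union_comm]
  exact (Finset.erase_inj _ ha).1 key

theorem Finset.Nonempty.erase_of_one_lt_card {α : Type*} [DecidableEq α] {S : Finset α}
    (h : 1 < S.card) (a : α) : (S.erase a).Nonempty := by
  rw [← Finset.card_pos]
  have := Finset.pred_card_le_card_erase (s := S) (a := a)
  omega

/-- All but at most one element can be deleted from a pair of disjoint nonempty sets whose total
size is at least three. -/
theorem exists_deletable {α : Type*} [DecidableEq α] {S T : Finset α} (h : Disjoint S T)
    (hS : S.Nonempty) (hT : T.Nonempty) (hcard : 3 ≤ S.card + T.card) :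
    ∃ A ⊆ S ∪ T, S.card + T.card ≤ A.card + 1 ∧
      ∀ a ∈ A, (S.erase a).Nonempty ∧ (T.erase a).Nonempty := by
  have hS' := hS.card_pos
  have hT' := hT.card_pos
  by_cases h₁ : S.card = 1
  · refine ⟨T, Finset.subset_union_right, by omega, fun a ha => ⟨?_, ?_⟩⟩
    · rwa [Finset.erase_eq_of_notMem (Finset.disjoint_right.1 h ha)]
    · exact .erase_of_one_lt_card (by omega) a
  by_cases h₂ : T.card = 1
  · refine ⟨S, Finset.subset_union_left, by omega, fun a ha => ⟨?_, ?_⟩⟩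
    · exact .erase_of_one_lt_card (by omega) a
    · rwa [Finset.erase_eq_of_notMem (Finset.disjoint_left.1 h ha)]
  refine ⟨S ∪ T, subset_rfl, by rw [Finset.card_union_of_disjoint h]; omega, fun a _ => ⟨?_, ?_⟩⟩
  · exact .erase_of_one_lt_card (by omega) a
  · exact .erase_of_one_lt_card (by omega) a

/-- The pairs obtained from `{S, T}` by adding an element outside `S ∪ T` to one of the parts. -/
def extensions {α : Type*} [Fintype α] [DecidableEq α] (S T : Finset α) :
    Finset (Sym2 (Finset α)) :=
  (S ∪ T)ᶜ.image (fun a => s(insert a S, T)) ∪ (S ∪ T)ᶜ.image (fun a => s(S, insert a T))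

theorem card_extensions_le {α : Type*} [Fintype α] [DecidableEq α] (S T : Finset α) :
    (extensions S T).card ≤ 2 * (S ∪ T)ᶜ.card := by
  rw [two_mul]
  exact (Finset.card_union_le _ _).trans (add_le_add Finset.card_image_le Finset.card_image_le)

theorem mem_extensions_of_erase {α : Type*} [Fintype α] [DecidableEq α] {S T S' T' : Finset α}
    {a : α} (h : Disjoint S T) (ha : a ∈ S) (heq : s(S', T') = s(S.erase a, T)) :
    s(S, T) ∈ extensions S' T' := by
  have haT := Finset.disjoint_left.1 h ha
  rw [extensions, Finset.mem_union]
  rcases Sym2.eq_iff.1 heq with ⟨rfl, rfl⟩ | ⟨rfl, rfl⟩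
  · left
    exact Finset.mem_image.2 ⟨a, by simp [haT], by rw [Finset.insert_erase ha]⟩
  · right
    exact Finset.mem_image.2 ⟨a, by simp [haT], by rw [Finset.insert_erase ha, Sym2.eq_swap]⟩

theorem stmt8 (n d : ℕ) (hn : 3 ≤ n) (hd1 : 1 ≤ d) (hd2 : 3 * d ≤ n)
    (𝒮 : Set (Sym2 (Finset (Fin n))))
    (h𝒮 : ∀ z ∈ 𝒮, ∃ S T : Finset (Fin n), z = s(S, T) ∧ Disjoint S T ∧
      S.Nonempty ∧ T.Nonempty ∧ S.card + T.card = n - d + 1) :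
    𝒮.ncard ≤
      Set.ncard {z' : Sym2 (Finset (Fin n)) |
        (∃ S' T' : Finset (Fin n), z' = s(S', T') ∧ Disjoint S' T' ∧
          S'.Nonempty ∧ T'.Nonempty ∧ S'.card + T'.card = n - d) ∧
        ∃ z ∈ 𝒮, ∃ S T : Finset (Fin n), ∃ a ∈ S,
          z = s(S, T) ∧ (S.erase a).Nonempty ∧ z' = s(S.erase a, T)} := by
  classical
  set N : Set (Sym2 (Finset (Fin n))) := {z' | _}
  have hpair : ∀ {S T : Finset (Fin n)}, s(S, T) ∈ 𝒮 → Disjoint S T ∧ S.Nonempty ∧ T.Nonempty ∧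
      S.card + T.card = n - d + 1 := by
    intro S T h
    obtain ⟨S₁, T₁, heq, hdis, hS, hT, hc⟩ := h𝒮 _ h
    rcases Sym2.eq_iff.1 heq with ⟨rfl, rfl⟩ | ⟨rfl, rfl⟩
    · exact ⟨hdis, hS, hT, hc⟩
    · exact ⟨hdis.symm, hT, hS, by omega⟩
  have hmem : ∀ z ∈ 𝒮, ∀ z', IsDeletion z z' → z' ∈ N := by
    rintro _ hz _ ⟨S, T, a, ha, rfl, hne, rfl⟩
    obtain ⟨hdis, -, hT, hc⟩ := hpair hz
    have := Finset.card_erase_add_one ha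
    exact ⟨⟨S.erase a, T, rfl, hdis.mono_left (Finset.erase_subset _ _), hne, hT, by omega⟩,
      _, hz, S, T, a, ha, rfl, hne, rfl⟩
  rw [Set.ncard_eq_toFinset_card', Set.ncard_eq_toFinset_card']
  have hcount : 𝒮.toFinset.card * (n - d) ≤ N.toFinset.card * (2 * d) := by
    refine Finset.card_mul_le_card_mul IsDeletion (fun z hz => ?_) (fun z' hz' => ?_)
    · rw [Set.mem_toFinset] at hz
      obtain ⟨S, T, rfl, hdis, hS, hT, hc⟩ := h𝒮 z hz
      obtain ⟨A, hA, hAcard, hdel⟩ := exists_deletable hdis hS hT (by omega)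
      calc n - d ≤ A.card := by omega
        _ = (A.image fun a => s(S.erase a, T.erase a)).card :=
          (Finset.card_image_of_injOn ((injOn_erase_pair S T).mono hA)).symm
        _ ≤ _ := by
          refine Finset.card_le_card (Finset.image_subset_iff.2 fun a ha => ?_)
          have hr := isDeletion_erase hdis (hA ha) (hdel a ha).1 (hdel a ha).2
          exact (Finset.mem_bipartiteAbove _).2 ⟨Set.mem_toFinset.2 (hmem _ hz _ hr), hr⟩
    · rw [Set.mem_toFinset] at hz'
      obtain ⟨⟨S', T', rfl, hdis, -, -, hc⟩, -⟩ := hz'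
      calc _ ≤ (extensions S' T').card := by
            refine Finset.card_le_card fun z hz => ?_
            obtain ⟨hz, S, T, a, ha, rfl, -, heq⟩ := (Finset.mem_bipartiteBelow _).1 hz
            exact mem_extensions_of_erase (hpair (Set.mem_toFinset.1 hz)).1 ha heq
        _ ≤ 2 * (S' ∪ T')ᶜ.card := card_extensions_le S' T'
        _ ≤ 2 * d := by
            rw [Finset.card_compl, Finset.card_union_of_disjoint hdis, Fintype.card_fin]
            omega
  refine Nat.le_of_mul_le_mul_right (hcount.trans ?_) (show 0 < n - d by omega)
  exact Nat.mul_le_mul_left _ (by omega)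
end
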